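/- Under the normalized setup with the quadratic asymptotic expansion, for every (x,t) ∈ ℝ^{n+1}_− and every positive integer k: Δ_k^tu(x,t) = −τ, where Δ_k^tu(x,t) := (u(x,t) − u(x,t−k))/k. -/

import Mathlib

open Set MeasureTheory

noncomputable section

abbrev En (n : ℕ) : Type := EuclideanSpace ℝ (Fin n)

namespace PMA

variable {n : ℕ}

/-- The lower half-space `ℝⁿ × (−∞,0]`. -/
def halfSpace (n : ℕ) : Set (En n × ℝ) := univ ×ˢ Iic (0:ℝ)

/-- The time derivative `u_t`. -/
def timeDeriv (u : En n → ℝ → ℝ) (x : En n) (t : ℝ) : ℝ := deriv (u x) t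

/-- The spatial gradient `D_x u`. -/
def spaceGrad (u : En n → ℝ → ℝ) (x : En n) (t : ℝ) : En n := gradient (fun y => u y t) x

/-- The spatial Hessian `D_x² u`, as an `n × n` matrix. -/
def spaceHess (u : En n → ℝ → ℝ) (x : En n) (t : ℝ) : Matrix (Fin n) (Fin n) ℝ :=
  fun i j => iteratedFDeriv ℝ 2 (fun y => u y t) x
    ![EuclideanSpace.single i 1, EuclideanSpace.single j 1]

/-- A function is parabolically convex on `D` if it is convex in `x` and nonincreasing in `t`. -/
def ParabolicallyConvexOn (D : Set (En n × ℝ)) (u : En n → ℝ → ℝ) : Prop :=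
  (∀ t : ℝ, ConvexOn ℝ {x | (x, t) ∈ D} (fun x => u x t)) ∧
  (∀ x : En n, ∀ s t : ℝ, s ≤ t → (x, s) ∈ D → (x, t) ∈ D → u x t ≤ u x s)

/-- The time slice `D(t)`. -/
def slice (D : Set (En n × ℝ)) (t : ℝ) : Set (En n) := {x | (x, t) ∈ D}

/-- Bowl-shaped domain. -/
def IsBowlShaped (D : Set (En n × ℝ)) : Prop :=
  D ⊆ halfSpace n ∧ (∀ t, Convex ℝ (slice D t)) ∧
  ∀ t₁ t₂ : ℝ, t₁ ≤ t₂ → (slice D t₂).Nonempty → slice D t₁ ⊆ slice D t₂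

/-- The parabolic boundary `∂_p D`. -/
def parabolicBoundary (D : Set (En n × ℝ)) : Set (En n × ℝ) :=
  (closure (slice D (sInf {t | (slice D t).Nonempty})) ×ˢ
      ({sInf {t | (slice D t).Nonempty}} : Set ℝ)) ∪
  ⋃ t ∈ Iic (0:ℝ), frontier (slice D t) ×ˢ ({t} : Set ℝ)

/-- Parabolic distance between two points. -/
def pdist (X Y : En n × ℝ) : ℝ := Real.sqrt (‖X.1 - Y.1‖^2 + |X.2 - Y.2|)

/-- Parabolic distance from a point to a set. -/
def pdistSet (Z : En n × ℝ) (S : Set (En n × ℝ)) : ℝ := sInf (pdist Z '' S)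

/-- `C^{2k,k}` regularity on a set: all mixed derivatives `D_x^i D_t^j u` with `i + 2j ≤ 2k`
exist and are continuous. -/
def IsC2kOn (k : ℕ) (u : En n → ℝ → ℝ) (D : Set (En n × ℝ)) : Prop :=
  ∀ i j : ℕ, i + 2*j ≤ 2*k →
    (∀ p ∈ D, ContDiffAt ℝ i (fun y => iteratedDeriv j (u y) p.2) p.1 ∧
      ContDiffAt ℝ j (u p.1) p.2) ∧
    ContinuousOn
      (fun p : En n × ℝ => iteratedFDeriv ℝ i (fun y => iteratedDeriv j (u y) p.2) p.1) D

/-- A matrix acting on `ℝⁿ`. -/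
def mApply (M : Matrix (Fin n) (Fin n) ℝ) (x : En n) : En n :=
  (WithLp.equiv 2 (Fin n → ℝ)).symm (M.mulVec (WithLp.equiv 2 (Fin n → ℝ) x))

/-- The quadratic form `xᵀ A x`. -/
def quadForm (A : Matrix (Fin n) (Fin n) ℝ) (x : En n) : ℝ := ∑ i, ∑ j, A i j * x i * x j

/-- The dot product `b · x` on `ℝⁿ`. -/
def dotp (b x : En n) : ℝ := ∑ i, b i * x i

/-- Second-order difference quotient `Δ_e² u`. -/
def sdq (u : En n → ℝ → ℝ) (e : En n) (x : En n) (t : ℝ) : ℝ :=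
  (u (x + e) t + u (x - e) t - 2 * u x t) / ‖e‖^2

end PMA

/-- A form of superadditivity of the geometric mean. -/
theorem prod_le_sub_one_pow_of_prod_one_add_eq {ι : Type*} [Fintype ι] [Nonempty ι] (μ : ι → ℝ)
    (hμ : ∀ i, 0 ≤ μ i) {r : ℝ} (hr : 0 < r)
    (h : ∏ i, (1 + μ i) = r ^ Fintype.card ι) :
    ∏ i, μ i ≤ (r - 1) ^ Fintype.card ι := by
  set N := Fintype.card ι with hN
  have hN0 : (N : ℝ) ≠ 0 := by simp [hN]
  have hNn : N ≠ 0 := by simp [hN]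
  have amgm : ∀ z : ι → ℝ, (∀ i, 0 ≤ z i) → (∏ i, z i) ^ ((N : ℝ)⁻¹) ≤ ∑ i, (N : ℝ)⁻¹ * z i := by
    intro z hz
    have := Real.geom_mean_le_arith_mean_weighted Finset.univ (fun _ => (N : ℝ)⁻¹) z
      (fun i _ => by positivity) (by simp [hN]) (fun i _ => hz i)
    rwa [Real.finsetProd_rpow _ _ (fun i _ => hz i)] at this
  have h1 := amgm (fun i => 1 / (1 + μ i)) (fun i => by have := hμ i; positivity)
  have h2 := amgm (fun i => μ i / (1 + μ i)) (fun i => by have := hμ i; positivity)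
  rw [Finset.prod_div_distrib, h] at h1 h2
  have hP : 0 ≤ ∏ i, μ i := Finset.prod_nonneg fun i _ => hμ i
  have hsum : ∑ i, (N : ℝ)⁻¹ * (1 / (1 + μ i)) + ∑ i, (N : ℝ)⁻¹ * (μ i / (1 + μ i)) = 1 := by
    rw [← Finset.sum_add_distrib]
    have : ∀ i, (N : ℝ)⁻¹ * (1 / (1 + μ i)) + (N : ℝ)⁻¹ * (μ i / (1 + μ i)) = (N : ℝ)⁻¹ := by
      intro i
      have := hμ i
      have h' : (1 + μ i) ≠ 0 := by positivity
      field_simp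
    rw [Finset.sum_congr rfl fun i _ => this i, Finset.sum_const, Finset.card_univ, ← hN,
      nsmul_eq_mul, mul_inv_cancel₀ hN0]
  rw [Finset.prod_const_one, Real.div_rpow zero_le_one (by positivity),
    Real.pow_rpow_inv_natCast hr.le hNn, Real.one_rpow] at h1
  rw [Real.div_rpow hP (by positivity), Real.pow_rpow_inv_natCast hr.le hNn] at h2
  have h3 : (∏ i, μ i) ^ ((N : ℝ)⁻¹) ≤ r - 1 := by
    have : (1 + (∏ i, μ i) ^ ((N : ℝ)⁻¹)) / r ≤ 1 := by
      rw [add_div]; linarith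
    rw [div_le_one hr] at this
    linarith
  calc ∏ i, μ i = ((∏ i, μ i) ^ ((N : ℝ)⁻¹)) ^ N := (Real.rpow_inv_natCast_pow hP hNn).symm
    _ ≤ _ := pow_le_pow_left₀ (by positivity) h3 _

/-- Minkowski's determinant inequality for the parabolic Monge–Ampère operator. -/
theorem mul_det_le_of_mul_det_add_eq {n : ℕ} {P Z : Matrix (Fin n) (Fin n) ℝ} (hP : P.PosDef)
    (hZ : Z.PosSemidef) {p z a b f : ℝ} (hp : 0 < p) (hz : 0 ≤ z) (ha : 0 < a) (hb : 0 < b)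
    (hf : 0 < f) (h1 : p * P.det = a ^ (n + 1) * f) (h2 : (p + z) * (P + Z).det = b ^ (n + 1) * f) :
    z * Z.det ≤ (b - a) ^ (n + 1) * f := by
  obtain ⟨S, rfl⟩ : ∃ S : Matrix (Fin n) (Fin n) ℝ, P = S.conjTranspose * S := by
    open scoped MatrixOrder in
    exact CStarAlgebra.nonneg_iff_eq_star_mul_self.1 hP.posSemidef.nonneg
  have hSd : IsUnit S.det := by
    have := hP.det_pos.ne'
    rw [Matrix.det_mul] at this
    exact (right_ne_zero_of_mul this).isUnit
  set Y := S⁻¹.conjTranspose * Z * S⁻¹ with hY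
  have hYpsd : Y.PosSemidef := hZ.conjTranspose_mul_mul_same _
  have hZY : Z = S.conjTranspose * Y * S := by
    have e1 : S.conjTranspose * S⁻¹.conjTranspose = 1 := by
      rw [← Matrix.conjTranspose_mul, Matrix.nonsing_inv_mul _ hSd, Matrix.conjTranspose_one]
    calc Z = (S.conjTranspose * S⁻¹.conjTranspose) * Z * (S⁻¹ * S) := by
          rw [e1, Matrix.nonsing_inv_mul _ hSd]; simp
      _ = _ := by rw [hY]; simp only [Matrix.mul_assoc]
  set ev := hYpsd.1.eigenvalues with hev
  have hev0 : ∀ i, 0 ≤ ev i := hYpsd.eigenvalues_nonneg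
  have hdetY : Y.det = ∏ i, ev i := by simpa using hYpsd.1.det_eq_prod_eigenvalues
  have hdet1Y : (1 + Y).det = ∏ i, (1 + ev i) := by
    have h := congrArg (Polynomial.eval (-1)) hYpsd.1.charpoly_eq
    rw [Matrix.eval_charpoly, Polynomial.eval_prod] at h
    have e : Matrix.scalar (Fin n) (-1 : ℝ) - Y = -(1 + Y) := by
      rw [map_neg, map_one]; abel
    simp only [Polynomial.eval_sub, Polynomial.eval_X, Polynomial.eval_C, RCLike.ofReal_real_eq_id,
      id, e, Matrix.det_neg, Fintype.card_fin] at h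
    have e2 : ∏ i, (-1 - ev i) = (-1) ^ n * ∏ i, (1 + ev i) := by
      have : ∀ i, -1 - ev i = (-1) * (1 + ev i) := fun i => by ring
      simp_rw [this]
      rw [Finset.prod_mul_distrib]
      simp
    exact mul_left_cancel₀ (pow_ne_zero n (by norm_num : (-1 : ℝ) ≠ 0)) (h.trans e2)
  have hdS : (S.conjTranspose * S).det ≠ 0 := hP.det_pos.ne'
  have hZd : Z.det = (S.conjTranspose * S).det * ∏ i, ev i := by
    rw [hZY, ← hdetY]; simp only [Matrix.det_mul]; ring
  have hPZd : (S.conjTranspose * S + Z).det = (S.conjTranspose * S).det * ∏ i, (1 + ev i) := by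
    have : S.conjTranspose * S + Z = S.conjTranspose * (1 + Y) * S := by
      rw [Matrix.mul_add, Matrix.add_mul, Matrix.mul_one, ← hZY]
    rw [this, ← hdet1Y]; simp only [Matrix.det_mul]; ring
  have key := prod_le_sub_one_pow_of_prod_one_add_eq (fun o : Option (Fin n) => o.elim (z / p) ev)
    (by rintro (_ | i) <;> simp [hev0]; positivity) (r := b / a) (by positivity) (by
      simp only [Fintype.prod_option, Option.elim, Fintype.card_option, Fintype.card_fin]
      have hd := hP.det_pos
      rw [hPZd] at h2
      rw [div_pow, eq_div_iff (by positivity)]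
      have : (p + z) = p * (1 + z / p) := by field_simp
      rw [this] at h2
      have h4 : a ^ (n+1) * f * ((1 + z / p) * ∏ i, (1 + ev i)) = b ^ (n+1) * f := by
        rw [← h1, ← h2]; ring
      have := mul_right_cancel₀ hf.ne' (a := ((1 + z / p) * ∏ i, (1 + ev i)) * a ^ (n+1))
        (c := b ^ (n+1)) (by linarith)
      linarith)
  simp only [Fintype.prod_option, Option.elim, Fintype.card_option, Fintype.card_fin] at key
  have : (b - a) ^ (n+1) * f = (a ^ (n+1) * f) * (b / a - 1) ^ (n+1) := by
    rw [show b / a - 1 = (b - a) / a by field_simp, div_pow]; field_simp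
  rw [this, hZd, ← h1]
  calc z * ((S.conjTranspose * S).det * ∏ i, ev i)
      = (p * (S.conjTranspose * S).det) * (z / p * ∏ i, ev i) := by field_simp
    _ ≤ _ := by
      refine mul_le_mul_of_nonneg_left key ?_
      have := hP.det_pos
      positivity

theorem nonneg_of_isLocalMin_of_hasDerivAt {φ φ' : ℝ → ℝ} {c : ℝ} (h1 : ∀ s, HasDerivAt φ (φ' s) s)
    (h2 : HasDerivAt φ' c 0) (hmin : IsLocalMin φ 0) : 0 ≤ c := by
  by_contra! hc
  have hd : deriv φ = φ' := funext fun s => (h1 s).deriv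
  have hmax : IsLocalMax φ 0 := by
    refine isLocalMax_of_deriv_deriv_neg ?_ hmin.deriv_eq_zero (h1 0).continuousAt
    rw [hd, h2.deriv]; exact hc
  have he : φ =ᶠ[nhds 0] fun _ => φ 0 := by
    filter_upwards [hmin, hmax] with s hs1 hs2 using le_antisymm hs2 hs1
  have he' : φ' =ᶠ[nhds 0] fun _ => 0 := by
    filter_upwards [he.eventuallyEq_nhds] with s hs
    rw [← hd, hs.deriv_eq]; simp
  have := he'.deriv_eq
  rw [h2.deriv] at this
  simp at this
  linarith

/-- Necessary first and second order conditions at a local minimum of `f - ⟪p, ·⟫`. -/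
theorem gradient_eq_and_nonneg_of_isLocalMin {n : ℕ} {f : En n → ℝ} {G : En n → En n}
    {D : En n →L[ℝ] En n} {x p : En n} (hG : ∀ y, HasGradientAt f (G y) y)
    (hD : HasFDerivAt G D x) (hmin : IsLocalMin (fun y => f y - inner ℝ p y) x) :
    G x = p ∧ ∀ v, 0 ≤ inner ℝ v (D v) := by
  have hline : ∀ v : En n, ∀ s : ℝ, HasDerivAt (fun s : ℝ => x + s • v) v s := fun v s => by
    simpa using ((hasDerivAt_id s).smul_const v).const_add x
  have h1 : ∀ v : En n, ∀ s : ℝ, HasDerivAt (fun s : ℝ => f (x + s • v) - inner ℝ p (x + s • v))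
      (inner ℝ (G (x + s • v) - p) v) s := by
    intro v s
    have a := (hG (x + s • v)).hasFDerivAt.comp_hasDerivAt s (hline v s)
    have b := (innerSL ℝ p).hasFDerivAt.comp_hasDerivAt s (hline v s)
    refine (a.sub b).congr_deriv ?_
    simp [inner_sub_left]
  have hm : ∀ v : En n, IsLocalMin (fun s : ℝ => f (x + s • v) - inner ℝ p (x + s • v)) 0 := by
    intro v
    have ht : Filter.Tendsto (fun s : ℝ => x + s • v) (nhds 0) (nhds x) := by
      simpa using (hline v 0).continuousAt.tendsto
    have := ht.eventually hmin
    simpa [IsLocalMin, IsMinFilter] using this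
  refine ⟨?_, fun v => ?_⟩
  · have h := (hm (G x - p)).hasDerivAt_eq_zero (h1 (G x - p) 0)
    rw [zero_smul, add_zero, inner_self_eq_zero] at h
    exact sub_eq_zero.1 h
  · refine nonneg_of_isLocalMin_of_hasDerivAt (h1 v) ?_ (hm v)
    have hx : HasFDerivAt G D (x + (0 : ℝ) • v) := by simpa using hD
    have a := hx.comp_hasDerivAt (0 : ℝ) (hline v 0)
    have b := (innerSL ℝ v).hasFDerivAt.comp_hasDerivAt (0 : ℝ) (a.sub_const p)
    simpa [real_inner_comm, Function.comp_def] using b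

theorem setLIntegral_le_of_mul_abs_det_le {n : ℕ} {g : En n → En n}
    {D : En n → En n →L[ℝ] En n} {S B : Set (En n)} {F : En n → ENNReal} {θ : ENNReal}
    (hS : MeasurableSet S) (hF : Measurable F) (hgm : Measurable g)
    (hg : ∀ x ∈ S, HasFDerivWithinAt g (D x) S x) (hBS : B ⊆ g '' S)
    (h0 : ∀ x ∈ S, F (g x) ≠ 0) (htop : ∀ x ∈ S, F (g x) ≠ ⊤)
    (hθ : ∀ x ∈ S, F (g x) * ENNReal.ofReal |(D x).det| ≤ θ) :
    ∫⁻ p in B, F p ≤ θ * volume S := by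
  set ν := Measure.map g ((volume.restrict S).withDensity fun x => θ / F (g x)) with hν
  have hdm : Measurable fun x => θ / F (g x) := (measurable_const.div (hF.comp hgm))
  have hle : volume.restrict B ≤ ν := by
    refine Measure.le_iff.2 fun E hE => ?_
    rw [Measure.restrict_apply hE, hν, Measure.map_apply hgm hE, withDensity_apply _ (hgm hE),
      Measure.restrict_restrict (hgm hE)]
    have hm : MeasurableSet (g ⁻¹' E ∩ S) := (hgm hE).inter hS
    calc volume (E ∩ B) ≤ volume (g '' (g ⁻¹' E ∩ S)) := by
          refine measure_mono ?_
          rintro p ⟨hpE, hpB⟩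
          obtain ⟨x, hx, rfl⟩ := hBS hpB
          exact ⟨x, ⟨hpE, hx⟩, rfl⟩
      _ ≤ ∫⁻ x in g ⁻¹' E ∩ S, ENNReal.ofReal |(D x).det| :=
          addHaar_image_le_lintegral_abs_det_fderiv volume hm fun x hx =>
            (hg x hx.2).mono Set.inter_subset_right
      _ ≤ ∫⁻ x in g ⁻¹' E ∩ S, θ / F (g x) := by
          refine setLIntegral_mono' hm fun x hx => ?_
          rw [ENNReal.le_div_iff_mul_le (Or.inl (h0 x hx.2)) (Or.inl (htop x hx.2)), mul_comm]
          exact hθ x hx.2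
  calc ∫⁻ p in B, F p ≤ ∫⁻ p, F p ∂ν := lintegral_mono' hle le_rfl
    _ = ∫⁻ x in S, (θ / F (g x)) * F (g x) := by
        rw [hν, lintegral_map hF hgm]
        exact lintegral_withDensity_eq_lintegral_mul _ hdm (hF.comp hgm)
    _ ≤ ∫⁻ _ in S, θ := by
        refine setLIntegral_mono' hS fun x hx => ?_
        rw [ENNReal.div_mul_cancel (h0 x hx) (htop x hx)]
    _ = θ * volume S := by simp

/-- The truncated parametric minimum of a continuous function over a compact set. -/
theorem exists_truncated_min {P X : Type*} [TopologicalSpace P] [TopologicalSpace X] {K : Set X}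
    (hK : IsCompact K) (hne : K.Nonempty) {f : P → X → ℝ} (hf : Continuous (Function.uncurry f))
    (L : ℝ) : ∃ μ : P → ℝ, Continuous μ ∧ (∀ q, μ q ≤ L) ∧ (∀ q, ∀ x ∈ K, μ q ≤ f q x) ∧
      ∀ q, μ q < L → ∃ x ∈ K, f q x = μ q := by
  have hc : ∀ q, ContinuousOn (f q) K := fun q =>
    (hf.comp (Continuous.prodMk_right q)).continuousOn
  refine ⟨fun q => min L (sInf (f q '' K)), continuous_const.min (hK.continuous_sInf hf),
    fun q => min_le_left _ _, fun q x hx => ?_, fun q hq => ?_⟩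
  · obtain ⟨y, hy, hy1, hy2⟩ := hK.exists_sInf_image_eq_and_le hne (hc q)
    exact (min_le_right _ _).trans (hy1.le.trans (hy2 x hx))
  · obtain ⟨y, hy, hy1, hy2⟩ := hK.exists_sInf_image_eq_and_le hne (hc q)
    refine ⟨y, hy, ?_⟩
    rw [← hy1]
    simp only [min_lt_iff, lt_self_iff_false, false_or] at hq
    exact (min_eq_right hq.le).symm

theorem ofReal_integral_le_lintegral_ofReal {α : Type*} [MeasurableSpace α] {μ : Measure α}
    {f : α → ℝ} (hf : Integrable f μ) :
    ENNReal.ofReal (∫ x, f x ∂μ) ≤ ∫⁻ x, ENNReal.ofReal (f x) ∂μ := by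
  calc ENNReal.ofReal (∫ x, f x ∂μ) ≤ ENNReal.ofReal (∫ x, max (f x) 0 ∂μ) :=
        ENNReal.ofReal_le_ofReal (integral_mono hf hf.pos_part fun x => le_max_left _ _)
    _ = ∫⁻ x, ENNReal.ofReal (max (f x) 0) ∂μ :=
        ofReal_integral_eq_lintegral_ofReal hf.pos_part (ae_of_all _ fun x => le_max_right _ _)
    _ = _ := by simp

/-- Integral form of the monotone decay of a Lipschitz function. -/
theorem ofReal_sub_le_lintegral_neg_deriv {φ : ℝ → ℝ} {a b : ℝ} (hab : a ≤ b) {C : NNReal}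
    (hφ : LipschitzOnWith C φ (Icc a b)) :
    ENNReal.ofReal (φ a - φ b) ≤ ∫⁻ t in Ioo a b, ENNReal.ofReal (-deriv φ t) := by
  have hac : AbsolutelyContinuousOnInterval φ a b := by
    apply LipschitzOnWith.absolutelyContinuousOnInterval (K := C)
    rwa [uIcc_of_le hab]
  have hInt := (intervalIntegrable_iff_integrableOn_Ioo_of_le hab).1 hac.intervalIntegrable_deriv
  have h := hac.integral_deriv_eq_sub
  rw [intervalIntegral.integral_of_le hab, integral_Ioc_eq_integral_Ioo] at h
  have h2 : φ a - φ b = ∫ t in Ioo a b, -deriv φ t := by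
    rw [integral_neg, h]; ring
  rw [h2]
  exact ofReal_integral_le_lintegral_ofReal hInt.neg

/-- A parabolic Aleksandrov–Bakelman–Pucci estimate for functions which are twice differentiable
in space and once in time. -/
theorem parabolic_abp {n : ℕ} {V V' : En n → ℝ → ℝ} {G : En n → ℝ → En n}
    {H : En n → ℝ → En n →L[ℝ] En n} {a b L d r ρ θ C : ℝ} {Γ : Set (En n × ℝ)}
    (hab : a ≤ b) (hd : 0 < d) (hρ : 0 ≤ ρ) (hΓm : MeasurableSet Γ)
    (hVc : ContinuousOn (fun q : En n × ℝ => V q.1 q.2) (univ ×ˢ Icc a b))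
    (hV' : ∀ x, ∀ t ∈ Icc a b, HasDerivAt (V x) (V' x t) t)
    (hC : ∀ x, ∀ t ∈ Icc a b, |V' x t| ≤ C)
    (hG : ∀ x, ∀ t ∈ Ioo a b, HasGradientAt (fun y => V y t) (G x t) x)
    (hH : ∀ x, ∀ t ∈ Ioo a b, HasFDerivAt (fun y => G y t) (H x t) x)
    (hout : ∀ p, ‖p‖ < r → ∀ t ∈ Icc a b, ∀ x, ρ ≤ ‖x‖ → L ≤ V x t - inner ℝ p x)
    (hbot : ∀ p, ‖p‖ < r → ∀ x, L ≤ V x a - inner ℝ p x)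
    (htop : ∀ p, ‖p‖ < r → ∃ x, V x b - inner ℝ p x ≤ L - d)
    (hΓ : ∀ p, ‖p‖ < r → ∀ t ∈ Ioo a b, ∀ x, ‖x‖ < ρ → V x t - inner ℝ p x < L → (x, t) ∈ Γ)
    (hdet : ∀ x, ∀ t ∈ Ioo a b, (∀ v, 0 ≤ inner ℝ v (H x t v)) → V' x t ≤ 0 →
      -V' x t * |(H x t).det| ≤ θ) :
    ENNReal.ofReal d * volume (Metric.ball (0 : En n) r) ≤ ENNReal.ofReal θ * volume Γ := by
  have hclm : ∀ t, max a (min t b) ∈ Icc a b := fun t =>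
    ⟨le_max_left _ _, max_le hab (min_le_right _ _)⟩
  have hcl : ∀ t ∈ Icc a b, max a (min t b) = t := fun t ht => by
    rw [min_eq_left ht.2, max_eq_right ht.1]
  obtain ⟨ν, hνc, hνL, hνle, hνeq⟩ := exists_truncated_min
    (P := En n × ℝ) (isCompact_closedBall (0 : En n) ρ) (Metric.nonempty_closedBall.2 hρ)
    (f := fun q x => V x (max a (min q.2 b)) - inner ℝ q.1 x) (by
      refine Continuous.sub ?_ (by fun_prop)
      exact hVc.comp_continuous (f := fun z : (En n × ℝ) × En n => (z.2, max a (min z.1.2 b)))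
        (by fun_prop) fun z => ⟨mem_univ _, hclm _⟩) L
  set μ : En n → ℝ → ℝ := fun p t => ν (p, t) with hμ
  have hμc : Continuous (Function.uncurry μ) := hνc
  have hμle : ∀ p, ∀ t ∈ Icc a b, ∀ x, ‖x‖ ≤ ρ → μ p t ≤ V x t - inner ℝ p x := by
    intro p t ht x hx
    have := hνle (p, t) x (by simpa using hx)
    simpa only [hcl t ht] using this
  have hμeq : ∀ p, ∀ t ∈ Icc a b, μ p t < L → ∃ x, ‖x‖ ≤ ρ ∧ V x t - inner ℝ p x = μ p t := by
    intro p t ht h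
    obtain ⟨x, hx, hx2⟩ := hνeq (p, t) h
    exact ⟨x, by simpa using hx, by simpa only [hcl t ht] using hx2⟩
  have hC0 : 0 ≤ C := (abs_nonneg _).trans (hC 0 a ⟨le_rfl, hab⟩)
  have hlip : ∀ p, LipschitzOnWith C.toNNReal (μ p) (Icc a b) := by
    intro p
    have hVlip : ∀ x, LipschitzOnWith C.toNNReal (V x) (Icc a b) := fun x =>
      (convex_Icc a b).lipschitzOnWith_of_nnnorm_hasDerivWithin_le
        (fun t ht => (hV' x t ht).hasDerivWithinAt) fun t ht => by
          rw [← NNReal.coe_le_coe, coe_nnnorm, Real.norm_eq_abs, Real.coe_toNNReal _ hC0]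
          exact hC x t ht
    refine LipschitzOnWith.of_le_add_mul _ fun t ht s hs => ?_
    rcases (hνL (p, s)).lt_or_eq with h | h
    · obtain ⟨x, hx, hx2⟩ := hμeq p s hs h
      have h1 := hμle p t ht x hx
      have h2 := (hVlip x).le_add_mul ht hs
      linarith
    · have h1 : μ p t ≤ L := hνL (p, t)
      have h2 : μ p s = L := h
      rw [h2]
      exact h1.trans (le_add_of_nonneg_right (by positivity))
  set F : En n → ℝ → ENNReal := fun p t => ENNReal.ofReal (-deriv (μ p) t) with hF
  have hFm : Measurable (Function.uncurry F) :=
    (measurable_deriv_with_param hμc).neg.ennreal_ofReal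
  -- every slope in the ball sees a drop of size `d`
  have hA : ∀ p, ‖p‖ < r → ENNReal.ofReal d ≤ ∫⁻ t in Ioo a b, F p t := by
    intro p hp
    refine le_trans (ENNReal.ofReal_le_ofReal ?_) (ofReal_sub_le_lintegral_neg_deriv hab (hlip p))
    have h1 : L ≤ μ p a := by
      by_contra! h
      obtain ⟨x, hx, hx2⟩ := hμeq p a ⟨le_rfl, hab⟩ h
      have := hbot p hp x
      linarith
    have h2 : μ p b ≤ L - d := by
      obtain ⟨x, hx⟩ := htop p hp
      rcases lt_or_ge ‖x‖ ρ with h | h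
      · exact (hμle p b ⟨hab, le_rfl⟩ x h.le).trans hx
      · have := hout p hp b ⟨hab, le_rfl⟩ x h
        linarith
    linarith
  -- properties of a contact point
  have hcontact : ∀ p, ‖p‖ < r → ∀ t ∈ Ioo a b, F p t ≠ 0 → ∀ x, ‖x‖ ≤ ρ →
      V x t - inner ℝ p x = μ p t → G x t = p ∧ (x, t) ∈ Γ ∧
        (∀ v, 0 ≤ inner ℝ v (H x t v)) ∧ V' x t = deriv (μ p) t := by
    intro p hp t ht hFp x hx hxe
    have htI : t ∈ Icc a b := Ioo_subset_Icc_self ht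
    have hder : deriv (μ p) t < 0 := by
      by_contra! h
      exact hFp (by simp [hF, h])
    have hdiff : DifferentiableAt ℝ (μ p) t := differentiableAt_of_deriv_ne_zero hder.ne
    have hnL : μ p t < L := by
      refine lt_of_le_of_ne (hνL (p, t)) fun h => hder.ne ?_
      refine IsLocalMax.deriv_eq_zero (Filter.Eventually.of_forall fun s => ?_)
      exact (hνL (p, s)).trans h.ge
    have hxρ : ‖x‖ < ρ := by
      by_contra! h
      have := hout p hp t htI x h
      linarith
    have hloc : IsLocalMin (fun y => V y t - inner ℝ p y) x := by
      have : ∀ᶠ y in nhds x, ‖y‖ < ρ := continuous_norm.continuousAt.eventually_lt_const hxρ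
      filter_upwards [this] with y hy
      rw [hxe]
      exact hμle p t htI y hy.le
    obtain ⟨h1, h2⟩ := gradient_eq_and_nonneg_of_isLocalMin (fun y => hG y t ht) (hH x t ht) hloc
    refine ⟨h1, hΓ p hp t ht x hxρ (by linarith), h2, ?_⟩
    have hm : IsLocalMin (fun s => V x s - inner ℝ p x - μ p s) t := by
      filter_upwards [Icc_mem_nhds ht.1 ht.2] with s hs
      have := hμle p s hs x hx
      linarith
    have := hm.hasDerivAt_eq_zero (((hV' x t htI).sub_const _).sub hdiff.hasDerivAt)
    linarith
  have hB : ∀ t ∈ Ioo a b, ∫⁻ p in Metric.ball (0 : En n) r, F p t ≤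
      ENNReal.ofReal θ * volume ((fun x => (x, t)) ⁻¹' Γ) := by
    intro t ht
    have htI : t ∈ Icc a b := Ioo_subset_Icc_self ht
    have hGc : Continuous fun y => G y t :=
      continuous_iff_continuousAt.2 fun y => (hH y t ht).continuousAt
    have hVct : Continuous fun y => V y t := by
      exact hVc.comp_continuous (f := fun y => (y, t)) (by fun_prop) fun z => ⟨mem_univ _, htI⟩
    have hFt : Measurable fun p => F p t := hFm.comp (measurable_id.prodMk measurable_const)
    have hμt : Continuous fun p => μ p t := hμc.comp (by fun_prop : Continuous fun p => (p, t))
    set S : Set (En n) := {x | ‖G x t‖ < r ∧ ‖x‖ ≤ ρ ∧ V x t - inner ℝ (G x t) x = μ (G x t) t ∧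
      F (G x t) t ≠ 0} with hS
    have hSm : MeasurableSet S := by
      refine MeasurableSet.inter (measurableSet_lt hGc.norm.measurable measurable_const) ?_
      refine MeasurableSet.inter (measurableSet_le measurable_norm measurable_const) ?_
      refine MeasurableSet.inter (measurableSet_eq_fun ?_ ?_) ?_
      · exact (hVct.sub (hGc.inner continuous_id)).measurable
      · exact (hμt.comp hGc).measurable
      · exact (hFt.comp hGc.measurable) (measurableSet_singleton 0).compl
    set B : Set (En n) := Metric.ball 0 r ∩ {p | F p t ≠ 0} with hBdef
    have hBm : MeasurableSet B :=
      Metric.isOpen_ball.measurableSet.inter (hFt (measurableSet_singleton 0).compl)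
    have e1 : ∫⁻ p in Metric.ball (0 : En n) r, F p t = ∫⁻ p in B, F p t := by
      rw [← lintegral_indicator Metric.isOpen_ball.measurableSet, ← lintegral_indicator hBm]
      congr 1
      ext p
      by_cases h1 : p ∈ Metric.ball (0 : En n) r <;> by_cases h2 : F p t = 0 <;>
        simp [hBdef, indicator, h1, h2]
    rw [e1]
    have hSp : ∀ x ∈ S, (x, t) ∈ Γ ∧ (∀ v, 0 ≤ inner ℝ v (H x t v)) ∧
        V' x t = deriv (μ (G x t)) t := fun x hx =>
      (hcontact _ hx.1 t ht hx.2.2.2 x hx.2.1 hx.2.2.1).2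
    calc ∫⁻ p in B, F p t ≤ ENNReal.ofReal θ * volume S := by
          refine setLIntegral_le_of_mul_abs_det_le (g := fun y => G y t) (D := fun y => H y t) hSm
            hFt hGc.measurable (fun x _ => (hH x t ht).hasFDerivWithinAt) ?_ (fun x hx => hx.2.2.2)
            (fun x _ => ENNReal.ofReal_ne_top) ?_
          · rintro p ⟨hp, hFp⟩
            have hp : ‖p‖ < r := by simpa using hp
            have hnL : μ p t < L := by
              refine lt_of_le_of_ne (hνL (p, t)) fun h => hFp ?_
              have : deriv (μ p) t = 0 := by
                refine IsLocalMax.deriv_eq_zero (Filter.Eventually.of_forall fun s => ?_)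
                exact (hνL (p, s)).trans h.ge
              simp [hF, this]
            obtain ⟨x, hx, hxe⟩ := hμeq p t htI hnL
            obtain ⟨h1, -⟩ := hcontact p hp t ht hFp x hx hxe
            subst h1
            exact ⟨x, ⟨hp, hx, hxe, hFp⟩, rfl⟩
          · intro x hx
            obtain ⟨-, h2, h3⟩ := hSp x hx
            have hneg : V' x t ≤ 0 := by
              rw [h3]
              by_contra! h
              exact hx.2.2.2 (by simp [hF, h.le])
            change ENNReal.ofReal (-deriv (μ (G x t)) t) * _ ≤ _
            rw [← h3, ← ENNReal.ofReal_mul (by linarith)]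
            exact ENNReal.ofReal_le_ofReal (hdet x t ht h2 hneg)
      _ ≤ _ := by
          gcongr
          exact fun x hx => (hSp x hx).1
  calc ENNReal.ofReal d * volume (Metric.ball (0 : En n) r)
      = ∫⁻ _ in Metric.ball (0 : En n) r, ENNReal.ofReal d := by simp
    _ ≤ ∫⁻ p in Metric.ball (0 : En n) r, ∫⁻ t in Ioo a b, F p t :=
        setLIntegral_mono' Metric.isOpen_ball.measurableSet fun p hp => hA p (by simpa using hp)
    _ = ∫⁻ t in Ioo a b, ∫⁻ p in Metric.ball (0 : En n) r, F p t :=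
        lintegral_lintegral_swap hFm.aemeasurable
    _ ≤ ∫⁻ t in Ioo a b, ENNReal.ofReal θ * volume ((fun x => (x, t)) ⁻¹' Γ) :=
        setLIntegral_mono' measurableSet_Ioo hB
    _ ≤ ∫⁻ t, ENNReal.ofReal θ * volume ((fun x => (x, t)) ⁻¹' Γ) := setLIntegral_le_lintegral _ _
    _ = ENNReal.ofReal θ * volume Γ := by
        rw [lintegral_const_mul' _ _ ENNReal.ofReal_ne_top, Measure.volume_eq_prod,
          Measure.prod_apply_symm hΓm]
/-- A classical parabolically convex solution of `-u_t det D²u = f₁ f₂` on the lower half-space,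
together with its derivatives `g = -u_t`, `G = D u` and `D = D²u`. -/
structure ParabolicSolution {n : ℕ} (u g : En n → ℝ → ℝ) (G : En n → ℝ → En n)
    (D : En n → ℝ → Matrix (Fin n) (Fin n) ℝ) (f₁ : En n → ℝ) (f₂ : ℝ → ℝ) (m₁ m₂ : ℝ) : Prop where
  continuousOn : ContinuousOn (fun q : En n × ℝ => u q.1 q.2) (univ ×ˢ Iic 0)
  continuousOn_speed : ContinuousOn (fun q : En n × ℝ => g q.1 q.2) (univ ×ˢ Iic 0)
  hasDerivAt : ∀ x, ∀ t ≤ 0, HasDerivAt (u x) (-g x t) t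
  hasGradientAt : ∀ x, ∀ t ≤ 0, HasGradientAt (fun y => u y t) (G x t) x
  hasFDerivAt : ∀ x, ∀ t ≤ 0,
    HasFDerivAt (fun y => G y t) (Matrix.toEuclideanCLM (𝕜 := ℝ) (D x t)) x
  posDef : ∀ x, ∀ t ≤ 0, (D x t).PosDef
  convexOn : ∀ t ≤ 0, ConvexOn ℝ univ fun x => u x t
  speed_pos : 0 < m₁
  le_speed : ∀ x, ∀ t ≤ 0, m₁ ≤ g x t
  speed_le : ∀ x, ∀ t ≤ 0, g x t ≤ m₂
  eqn : ∀ x, ∀ t ≤ 0, g x t * (D x t).det = f₁ x * f₂ t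

theorem inner_toEuclideanCLM {n : ℕ} (M : Matrix (Fin n) (Fin n) ℝ) (v w : En n) :
    inner ℝ v (Matrix.toEuclideanCLM (𝕜 := ℝ) M w) = v.ofLp ⬝ᵥ (M.mulVec w.ofLp) := by
  rw [EuclideanSpace.inner_eq_star_dotProduct]
  simp [dotProduct_comm]

theorem det_toEuclideanCLM {n : ℕ} (M : Matrix (Fin n) (Fin n) ℝ) :
    (Matrix.toEuclideanCLM (𝕜 := ℝ) M).det = M.det := by
  rw [ContinuousLinearMap.det, Matrix.coe_toEuclideanCLM_eq_toEuclideanLin,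
    Matrix.toEuclideanLin_eq_toLin_orthonormal, LinearMap.det_toLin]

theorem ConvexOn.add_inner_le {n : ℕ} {f : En n → ℝ} (hf : ConvexOn ℝ univ f) {p x : En n}
    (h : HasGradientAt f p x) (y : En n) : f x + inner ℝ p (y - x) ≤ f y := by
  have hl : HasDerivAt (fun s : ℝ => x + s • (y - x)) (y - x) 0 := by
    simpa using ((hasDerivAt_id (0:ℝ)).smul_const (y - x)).const_add x
  have hx : HasGradientAt f p (x + (0:ℝ) • (y - x)) := by simpa using h
  have hd : HasDerivAt (fun s : ℝ => f (x + s • (y - x))) (inner ℝ p (y - x)) 0 := by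
    simpa [Function.comp_def] using hx.hasFDerivAt.comp_hasDerivAt (0:ℝ) hl
  have hc : ConvexOn ℝ univ (fun s : ℝ => f (x + s • (y - x))) := by
    have := hf.comp_affineMap (AffineMap.lineMap (k := ℝ) x y)
    have he : (fun s : ℝ => f (x + s • (y - x))) = f ∘ (AffineMap.lineMap (k := ℝ) x y) := by
      funext s
      simp [AffineMap.lineMap_apply, add_comm]
    rw [he]
    simpa using this
  have := hc.le_slope_of_hasDerivAt (mem_univ 0) (mem_univ 1) zero_lt_one hd
  simp [slope_def_field] at this
  rw [add_comm]; linarith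

theorem hessian_nonneg_of_convexOn {n : ℕ} {f : En n → ℝ} {G : En n → En n}
    {D : En n →L[ℝ] En n} {x : En n} (hf : ConvexOn ℝ univ f)
    (hG : ∀ y, HasGradientAt f (G y) y) (hD : HasFDerivAt G D x) (v : En n) :
    0 ≤ inner ℝ v (D v) := by
  refine (gradient_eq_and_nonneg_of_isLocalMin (p := G x) hG hD ?_).2 v
  refine Filter.Eventually.of_forall fun y => ?_
  have := hf.add_inner_le (hG x) y
  rw [inner_sub_right] at this
  simp only
  linarith

theorem Matrix.PosSemidef.posDef_of_det_pos {n : ℕ} {M : Matrix (Fin n) (Fin n) ℝ}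
    (hM : M.PosSemidef) (h : 0 < M.det) : M.PosDef :=
  hM.posDef_iff_isUnit.2 ((Matrix.isUnit_iff_isUnit_det M).2 h.ne'.isUnit)

theorem hasFDerivAt_gradient_toEuclideanCLM {n : ℕ} {f : En n → ℝ} {x : En n}
    (hf2 : ContDiffAt ℝ 2 f x) :
    let M : Matrix (Fin n) (Fin n) ℝ := fun i j => iteratedFDeriv ℝ 2 f x
      ![EuclideanSpace.single i 1, EuclideanSpace.single j 1]
    HasFDerivAt (gradient f) (Matrix.toEuclideanCLM (𝕜 := ℝ) M) x ∧ M.IsHermitian := by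
  intro M
  have hsym : IsSymmSndFDerivAt ℝ f x := hf2.isSymmSndFDerivAt (by simp)
  have h1 : ContDiffAt ℝ 1 (fderiv ℝ f) x := hf2.fderiv_right (by norm_num)
  have h2 : HasFDerivAt (fderiv ℝ f) (fderiv ℝ (fderiv ℝ f) x) x :=
    (h1.differentiableAt one_ne_zero).hasFDerivAt
  have hM : ∀ i j, M i j = fderiv ℝ (fderiv ℝ f) x (EuclideanSpace.single i 1)
      (EuclideanSpace.single j 1) := by
    intro i j
    simp [M, iteratedFDeriv_two_apply]
  refine ⟨?_, ?_⟩
  · have h3 := ((InnerProductSpace.toDual ℝ (En n)).symm.toContinuousLinearEquiv.toContinuousLinearMap.hasFDerivAt).comp x h2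
    refine HasFDerivAt.congr_fderiv (f := gradient f) h3 ?_
    refine ContinuousLinearMap.coe_injective
      ((EuclideanSpace.basisFun (Fin n) ℝ).toBasis.ext fun j => ?_)
    refine InnerProductSpace.ext_inner_left_basis (𝕜 := ℝ)
      (EuclideanSpace.basisFun (Fin n) ℝ).toBasis fun i => ?_
    simp only [ContinuousLinearMap.coe_coe]
    rw [inner_toEuclideanCLM]
    simp [hM, hsym.eq]
    rw [real_inner_comm, InnerProductSpace.toDual_symm_apply]
  · ext i j
    simp [hM, hsym.eq (EuclideanSpace.single i 1)]

theorem parabolicSolution_of_isC2kOn {n : ℕ} {u : En n → ℝ → ℝ} {f₁ : En n → ℝ} {f₂ : ℝ → ℝ}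
    {m₁ m₂ : ℝ} (hureg : PMA.IsC2kOn 1 u (PMA.halfSpace n))
    (huconv : PMA.ParabolicallyConvexOn (PMA.halfSpace n) u) (hm₁ : 0 < m₁)
    (hut : ∀ (x : En n) (t : ℝ), t ≤ 0 →
      m₁ ≤ -PMA.timeDeriv u x t ∧ -PMA.timeDeriv u x t ≤ m₂)
    (heq : ∀ (x : En n) (t : ℝ), t ≤ 0 →
      -PMA.timeDeriv u x t * (PMA.spaceHess u x t).det = f₁ x * f₂ t)
    (hf : ∀ (x : En n) (t : ℝ), t ≤ 0 → 0 < f₁ x * f₂ t) :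
    ParabolicSolution u (fun x t => -PMA.timeDeriv u x t) (PMA.spaceGrad u) (PMA.spaceHess u)
      f₁ f₂ m₁ m₂ := by
  have hmem : ∀ (x : En n) (t : ℝ), t ≤ 0 → (x, t) ∈ PMA.halfSpace n := fun x t ht =>
    ⟨mem_univ _, ht⟩
  have hc2 : ∀ x : En n, ∀ t ≤ 0, ContDiffAt ℝ 2 (fun y => u y t) x := fun x t ht => by
    simpa using ((hureg 2 0 (by norm_num)).1 (x, t) (hmem x t ht)).1
  have hconv : ∀ t ≤ (0:ℝ), ConvexOn ℝ univ fun x => u x t := fun t ht => by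
    have h := huconv.1 t
    have he : {x : En n | (x, t) ∈ PMA.halfSpace n} = univ := eq_univ_of_forall fun x => hmem x t ht
    rwa [he] at h
  have hgrad : ∀ x : En n, ∀ t ≤ 0, HasGradientAt (fun y => u y t) (PMA.spaceGrad u x t) x :=
    fun x t ht => ((hc2 x t ht).differentiableAt two_ne_zero).hasGradientAt
  have hhess : ∀ x : En n, ∀ t ≤ 0, HasFDerivAt (fun y => PMA.spaceGrad u y t)
      (Matrix.toEuclideanCLM (𝕜 := ℝ) (PMA.spaceHess u x t)) x := fun x t ht =>
    (hasFDerivAt_gradient_toEuclideanCLM (hc2 x t ht)).1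
  have hzero : ContinuousOn (fun q : En n × ℝ => u q.1 q.2) (univ ×ˢ Iic 0) := by
    have h := (hureg 0 0 (by norm_num)).2
    have h' : ContinuousOn (fun q : En n × ℝ => iteratedFDeriv ℝ 0
      (fun y => iteratedDeriv 0 (u y) q.2) q.1 (fun _ => 0)) (PMA.halfSpace n) :=
      (ContinuousMultilinearMap.apply ℝ (fun _ : Fin 0 => En n) ℝ
        (fun _ => 0)).continuous.comp_continuousOn h
    simpa [PMA.halfSpace, PMA.timeDeriv] using h'
  have hone : ContinuousOn (fun q : En n × ℝ => PMA.timeDeriv u q.1 q.2) (univ ×ˢ Iic 0) := by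
    have h := (hureg 0 1 (by norm_num)).2
    have h' : ContinuousOn (fun q : En n × ℝ => iteratedFDeriv ℝ 0
      (fun y => iteratedDeriv 1 (u y) q.2) q.1 (fun _ => 0)) (PMA.halfSpace n) :=
      (ContinuousMultilinearMap.apply ℝ (fun _ : Fin 0 => En n) ℝ
        (fun _ => 0)).continuous.comp_continuousOn h
    simpa [PMA.halfSpace, PMA.timeDeriv] using h'
  refine ⟨hzero, hone.neg, fun x t ht => ?_, hgrad, hhess, fun x t ht => ?_, hconv, hm₁,
    fun x t ht => (hut x t ht).1, fun x t ht => (hut x t ht).2, heq⟩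
  · have h : ContDiffAt ℝ 1 (u x) t := by
      simpa using ((hureg 0 1 (by norm_num)).1 (x, t) (hmem x t ht)).2
    simpa [PMA.timeDeriv] using (h.differentiableAt one_ne_zero).hasDerivAt
  · refine Matrix.PosSemidef.posDef_of_det_pos ?_ ?_
    · refine Matrix.PosSemidef.of_dotProduct_mulVec_nonneg
        (hasFDerivAt_gradient_toEuclideanCLM (hc2 x t ht)).2 fun v => ?_
      have h := hessian_nonneg_of_convexOn (hconv t ht) (fun y => hgrad y t ht) (hhess x t ht)
        (WithLp.toLp 2 v)
      rw [inner_toEuclideanCLM] at h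
      simpa using h
    · exact pos_of_mul_pos_right ((hf x t ht).trans_eq (heq x t ht).symm)
        (hm₁.le.trans (hut x t ht).1)

theorem quadForm_eq_inner {n : ℕ} (A : Matrix (Fin n) (Fin n) ℝ) (x : En n) :
    PMA.quadForm A x = inner ℝ x (Matrix.toEuclideanCLM (𝕜 := ℝ) A x) := by
  rw [inner_toEuclideanCLM]
  simp only [PMA.quadForm, dotProduct, Matrix.mulVec, Finset.mul_sum]
  exact Finset.sum_congr rfl fun i _ => Finset.sum_congr rfl fun j _ => by ring

theorem continuous_quadForm {n : ℕ} (A : Matrix (Fin n) (Fin n) ℝ) :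
    Continuous (PMA.quadForm A) := by
  simp only [funext (quadForm_eq_inner A)]
  fun_prop

theorem exists_pos_mul_sq_norm_le_quadForm {n : ℕ} {A : Matrix (Fin n) (Fin n) ℝ}
    (hA : A.PosDef) : ∃ a > 0, ∀ x : En n, a * ‖x‖ ^ 2 ≤ PMA.quadForm A x := by
  have hpos : ∀ x : En n, x ≠ 0 → 0 < PMA.quadForm A x := by
    intro x hx
    rw [quadForm_eq_inner, inner_toEuclideanCLM]
    have := hA.dotProduct_mulVec_pos (x := x.ofLp) (by simpa using hx)
    simpa using this
  have hscale : ∀ (c : ℝ) (x : En n), PMA.quadForm A (c • x) = c ^ 2 * PMA.quadForm A x := by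
    intro c x
    rw [quadForm_eq_inner, quadForm_eq_inner, map_smul, inner_smul_left, inner_smul_right]
    simp; ring
  rcases (Metric.sphere (0 : En n) 1).eq_empty_or_nonempty with he | hne
  · refine ⟨1, one_pos, fun x => ?_⟩
    have hx : x = 0 := by
      by_contra hx
      have : ‖x‖⁻¹ • x ∈ Metric.sphere (0 : En n) 1 := by
        simp [norm_smul, hx]
      rw [he] at this
      exact this
    simp [hx, quadForm_eq_inner]
  · obtain ⟨z, hz, hmin⟩ := (isCompact_sphere (0 : En n) 1).exists_isMinOn hne
      (continuous_quadForm A).continuousOn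
    refine ⟨PMA.quadForm A z, hpos z fun h => by simp [h] at hz, fun x => ?_⟩
    rcases eq_or_ne x 0 with rfl | hx
    · simp [quadForm_eq_inner]
    · have hx' : ‖x‖ ≠ 0 := norm_ne_zero_iff.2 hx
      have h := hmin (show ‖x‖⁻¹ • x ∈ Metric.sphere (0 : En n) 1 by simp [norm_smul, hx])
      simp only [mem_ofPred_eq] at h
      rw [hscale] at h
      calc PMA.quadForm A z * ‖x‖ ^ 2 ≤ (‖x‖⁻¹ ^ 2 * PMA.quadForm A x) * ‖x‖ ^ 2 := by gcongr
        _ = PMA.quadForm A x := by field_simp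

/-- A function asymptotic to the parabolic quadratic `½ xᵀAx - τt` up to a sublinear power of
`|x|² - t` is within `σ (|x|² - t) + C` of it, for every `σ > 0`. -/
theorem exists_abs_sub_quadratic_le {n : ℕ} {u : En n → ℝ → ℝ}
    {A : Matrix (Fin n) (Fin n) ℝ} {τ C₀ γ : ℝ} (hγ : γ < 1)
    (hu : ContinuousOn (fun q : En n × ℝ => u q.1 q.2) (univ ×ˢ Iic 0))
    (hasym : ∀ (x : En n) (t : ℝ), t ≤ 0 → C₀ ≤ ‖x‖ ^ 2 - t →
      |u x t - ((1 / 2) * PMA.quadForm A x - τ * t)| ≤ C₀ * (‖x‖ ^ 2 - t) ^ γ)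
    {σ : ℝ} (hσ : 0 < σ) : ∃ C, 0 ≤ C ∧ ∀ (x : En n) (t : ℝ), t ≤ 0 →
      |u x t - ((1 / 2) * PMA.quadForm A x - τ * t)| ≤ σ * (‖x‖ ^ 2 - t) + C := by
  have hlim : ∀ᶠ s : ℝ in Filter.atTop, C₀ * s ^ γ ≤ σ * s := by
    have h := (tendsto_rpow_neg_atTop (sub_pos.2 hγ)).const_mul C₀
    rw [mul_zero] at h
    filter_upwards [h.eventually_le_const hσ, Filter.eventually_gt_atTop 0] with s hs h0
    calc C₀ * s ^ γ = C₀ * s ^ (-(1 - γ)) * s := by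
          rw [mul_assoc, ← Real.rpow_add_one h0.ne']; ring_nf
      _ ≤ σ * s := by gcongr
  obtain ⟨S, hS⟩ := Filter.eventually_atTop.1 hlim
  set R := max (max S C₀) 1
  have hR1 : 1 ≤ R := le_max_right _ _
  have hcomp : IsCompact (Metric.closedBall (0 : En n) R ×ˢ Icc (-R) 0) :=
    (isCompact_closedBall _ _).prod isCompact_Icc
  have hcont : ContinuousOn (fun q : En n × ℝ =>
      u q.1 q.2 - ((1 / 2) * PMA.quadForm A q.1 - τ * q.2))
      (Metric.closedBall (0 : En n) R ×ˢ Icc (-R) 0) := by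
    refine (hu.mono (prod_mono (subset_univ _) Icc_subset_Iic_self)).sub ?_
    have := continuous_quadForm A
    fun_prop
  obtain ⟨C, hC⟩ := hcomp.exists_bound_of_continuousOn hcont
  refine ⟨max C 0, le_max_right _ _, fun x t ht => ?_⟩
  rcases le_total R (‖x‖ ^ 2 - t) with h | h
  · have h1 := hS _ ((le_max_left _ _).trans ((le_max_left _ _).trans h))
    have h2 := hasym x t ht ((le_max_right _ _).trans ((le_max_left _ _).trans h))
    linarith [le_max_right C 0]
  · have hx : ‖x‖ ≤ R := by nlinarith [norm_nonneg x]
    have h1 := hC (x, t) ⟨by simpa using hx, by nlinarith [sq_nonneg ‖x‖], ht⟩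
    rw [Real.norm_eq_abs] at h1
    nlinarith [le_max_left C 0, sq_nonneg ‖x‖, mul_nonneg hσ.le
      (by nlinarith [sq_nonneg ‖x‖] : 0 ≤ ‖x‖ ^ 2 - t)]

/-- The density constant in the point-to-measure estimate. -/
def densityConst (n : ℕ) (τ Λ κ : ℝ) : ℝ :=
  τ * κ ^ n * (volume (Metric.ball (0 : En n) 1)).toReal / (4 * Λ)

theorem densityConst_pos {n : ℕ} {τ Λ κ : ℝ} (hτ : 0 < τ) (hΛ : 0 < Λ) (hκ : 0 < κ) :
    0 < densityConst n τ Λ κ := by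
  have : 0 < (volume (Metric.ball (0 : En n) 1)).toReal :=
    ENNReal.toReal_pos (Metric.measure_ball_pos _ _ one_pos).ne' measure_ball_lt_top.ne
  unfold densityConst
  positivity

set_option maxHeartbeats 1000000 in
/-- Point-to-measure estimate: if `w ≥ 0` is small at one point, and `c u + w` satisfies the
determinant bound of the concave Monge–Ampère comparison, then `w` is small on a set of definite
parabolic density at large scales. -/
theorem le_volume_sublevel {n : ℕ} {u g : En n → ℝ → ℝ} {G : En n → ℝ → En n}
    {D : En n → ℝ → Matrix (Fin n) (Fin n) ℝ} {f₁ : En n → ℝ} {f₂ : ℝ → ℝ} {m₁ m₂ : ℝ}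
    (hS : ParabolicSolution u g G D f₁ f₂ m₁ m₂) {a₀ τ C₁ κ K Λ C δ : ℝ} (ha₀ : 0 < a₀)
    (hτ : 0 < τ) (hκ : 0 < κ) (hκ2 : 32 * κ ^ 2 = a₀ * τ) (hK : 0 < K) (hK2 : 8 * τ ≤ a₀ * K ^ 2)
    (hΛ : 0 < Λ) (hδ : 0 < δ)
    (hlow : ∀ x, ∀ t ≤ 0, a₀ / 4 * ‖x‖ ^ 2 + 15 / 16 * τ * -t - C₁ ≤ u x t)
    {w w' : En n → ℝ → ℝ} {wG : En n → ℝ → En n} {wH : En n → ℝ → Matrix (Fin n) (Fin n) ℝ}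
    (hw0 : ∀ x, ∀ t ≤ 0, 0 ≤ w x t)
    (hwc : ContinuousOn (fun q : En n × ℝ => w q.1 q.2) (univ ×ˢ Iic 0))
    (hw' : ∀ x, ∀ t ≤ 0, HasDerivAt (w x) (w' x t) t) (hwC : ∀ x, ∀ t ≤ 0, |w' x t| ≤ C)
    (hwG : ∀ x, ∀ t ≤ 0, HasGradientAt (fun y => w y t) (wG x t) x)
    (hwH : ∀ x, ∀ t ≤ 0, HasFDerivAt (fun y => wG y t)
      (Matrix.toEuclideanCLM (𝕜 := ℝ) (wH x t)) x)
    (hdet : ∀ c, 0 < c → c < 1 → ∀ x, ∀ t ≤ 0, (c • D x t + wH x t).PosSemidef →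
      c * -g x t + w' x t ≤ 0 → -(c * -g x t + w' x t) * (c • D x t + wH x t).det ≤
        c ^ (n + 1) * Λ)
    (hsymm : ∀ x, ∀ t ≤ 0, (wH x t).IsHermitian)
    {x₀ : En n} {t₀ : ℝ} (ht₀ : t₀ ≤ 0) (hw₀ : w x₀ t₀ ≤ δ) :
    ∀ᶠ N : ℕ in Filter.atTop, ENNReal.ofReal (densityConst n τ Λ κ * (N : ℝ) ^ (n + 2)) ≤
      volume {q : En n × ℝ | ‖q.1‖ < K * N ∧ q.2 ∈ Ioc (-(N : ℝ) ^ 2) 0 ∧ w q.1 q.2 ≤ 4 * δ} := by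
  have hlarge : ∀ B : ℝ, ∀ᶠ N : ℕ in Filter.atTop, B ≤ (N : ℝ) := fun B =>
    tendsto_natCast_atTop_atTop.eventually_ge_atTop B
  filter_upwards [hlarge 1, hlarge (16 * C₁ / τ), hlarge (-t₀), hlarge (4 * δ / τ + 1),
    hlarge (4 * (|u x₀ t₀| + κ * ‖x₀‖) / τ)] with N hN1 hNC hNt hNδ hNu
  have hN0 : (0:ℝ) < N := by linarith
  have hNsq : (N:ℝ) ≤ (N:ℝ) ^ 2 := by nlinarith
  rw [div_le_iff₀ hτ] at hNC hNu
  rw [← le_sub_iff_add_le, div_le_iff₀ hτ] at hNδ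
  set T : ℝ := (N:ℝ) ^ 2 with hT
  have hT0 : 0 < T := by positivity
  obtain ⟨c, hc⟩ : ∃ c, c * (τ * T) = 4 * δ := ⟨4 * δ / (τ * T), by field_simp⟩
  have hc0 : 0 < c := pos_of_mul_pos_left (by rw [hc]; positivity) (by positivity)
  have hc1 : c < 1 := by
    by_contra! h
    nlinarith [mul_pos hτ hT0]
  have hC1 : C₁ ≤ τ * T / 16 := by nlinarith
  have hkey : ∀ p : En n, ‖p‖ < κ * c * N → ∀ x, ∀ t ≤ 0,
      c * (a₀ / 8 * ‖x‖ ^ 2 + 15 / 16 * τ * -t - τ * T / 8) ≤ c * u x t - inner ℝ p x := by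
    intro p hp x t ht
    have h1 : inner ℝ p x ≤ κ * c * N * ‖x‖ :=
      (real_inner_le_norm p x).trans (by gcongr)
    have h2 : κ * N * ‖x‖ ≤ a₀ / 8 * ‖x‖ ^ 2 + τ * T / 16 := by
      have h3 : 0 ≤ (a₀ * ‖x‖ - 4 * κ * N) ^ 2 := sq_nonneg _
      have h4 : a₀ * (κ * N * ‖x‖) ≤ a₀ * (a₀ / 8 * ‖x‖ ^ 2 + τ * T / 16) := by
        have : κ ^ 2 * T * 32 = a₀ * τ * T := by rw [← hκ2]; ring
        nlinarith
      exact le_of_mul_le_mul_left h4 ha₀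
    have h5 := hlow x t ht
    have h6 : c * (a₀ / 8 * ‖x‖ ^ 2 + 15 / 16 * τ * -t - τ * T / 8) ≤
        c * (u x t - κ * N * ‖x‖) :=
      mul_le_mul_of_nonneg_left (by linarith) hc0.le
    linarith
  have hab : -T ≤ t₀ := by linarith
  set Γ : Set (En n × ℝ) :=
    {q : En n × ℝ | ‖q.1‖ < K * N ∧ q.2 ∈ Ioc (-T) 0 ∧ w q.1 q.2 ≤ 4 * δ} with hΓ
  have hΓm : MeasurableSet Γ := by
    have hcl : IsClosed ((univ ×ˢ Iic 0) ∩ (fun q : En n × ℝ => w q.1 q.2) ⁻¹' Iic (4 * δ)) :=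
      hwc.preimage_isClosed_of_isClosed (isClosed_univ.prod isClosed_Iic) isClosed_Iic
    have hb : MeasurableSet (Metric.ball (0 : En n) (K * N) ×ˢ Ioc (-T) 0) :=
      measurableSet_ball.prod measurableSet_Ioc
    convert hb.inter hcl.measurableSet using 1
    ext ⟨x, t⟩
    simp [Γ]
    tauto
  have habp := parabolic_abp (n := n) (V := fun x t => c * u x t + w x t)
    (V' := fun x t => c * -g x t + w' x t) (G := fun x t => c • G x t + wG x t)
    (H := fun x t => Matrix.toEuclideanCLM (𝕜 := ℝ) (c • D x t + wH x t))
    (a := -T) (b := t₀) (L := 3 / 4 * (c * (τ * T))) (d := c * (τ * T) / 4) (r := κ * c * N)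
    (ρ := K * N) (θ := c ^ (n + 1) * Λ) (C := m₂ + C) (Γ := Γ) hab (by positivity) (by positivity)
    hΓm ?_ ?_ ?_ ?_ ?_ ?_ ?_ ?_ ?_ ?_
  · rw [Measure.addHaar_ball_of_pos volume _ (by positivity), ← ENNReal.ofReal_toReal
      (measure_ball_lt_top (x := (0 : En n)) (r := 1) (μ := volume)).ne] at habp
    rw [finrank_euclideanSpace_fin, ← ENNReal.ofReal_mul (by positivity),
      ← ENNReal.ofReal_mul (by positivity)] at habp
    have hθ0 : 0 < c ^ (n + 1) * Λ := by positivity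
    rw [mul_comm (ENNReal.ofReal (c ^ (n + 1) * Λ)), ← ENNReal.div_le_iff (by simpa using hθ0) ENNReal.ofReal_ne_top,
      ← ENNReal.ofReal_div_of_pos hθ0] at habp
    refine le_trans (ENNReal.ofReal_le_ofReal (le_of_eq ?_)) habp
    unfold densityConst
    rw [hT]
    field_simp
    ring
  · refine ContinuousOn.mono ?_ (prod_mono (subset_univ _) (Icc_subset_Iic_self.trans
      (Iic_subset_Iic.2 ht₀)))
    exact (hS.continuousOn.const_mul c).add hwc
  · exact fun x t ht => ((hS.hasDerivAt x t (ht.2.trans ht₀)).const_mul c).add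
      (hw' x t (ht.2.trans ht₀))
  · intro x t ht
    have h0 := ht.2.trans ht₀
    have h1 := hS.le_speed x t h0
    have h2 := hS.speed_le x t h0
    have h3 := hS.speed_pos
    refine (abs_add_le _ _).trans (add_le_add ?_ (hwC x t h0))
    rw [abs_mul, abs_neg, abs_of_pos hc0, abs_of_pos (by linarith)]
    nlinarith
  · intro x t ht
    have h0 := ht.2.le.trans ht₀
    have h1 := (hS.hasGradientAt x t h0).hasFDerivAt.const_mul c
    have h2 := (hwG x t h0).hasFDerivAt
    rw [hasGradientAt_iff_hasFDerivAt, map_add, map_smul]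
    exact h1.add h2
  · intro x t ht
    have h0 := ht.2.le.trans ht₀
    rw [map_add, map_smul]
    exact ((hS.hasFDerivAt x t h0).const_smul c).add (hwH x t h0)
  · intro p hp t ht x hx
    have h0 := ht.2.trans ht₀
    have h1 := hkey p hp x t h0
    have h2 : τ * T ≤ a₀ / 8 * ‖x‖ ^ 2 := by
      have h3 : (K * N) ^ 2 ≤ ‖x‖ ^ 2 := by gcongr
      rw [mul_pow, ← hT] at h3
      nlinarith
    have h4 : c * (3 / 4 * (τ * T)) ≤
        c * (a₀ / 8 * ‖x‖ ^ 2 + 15 / 16 * τ * -t - τ * T / 8) := by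
      refine mul_le_mul_of_nonneg_left ?_ hc0.le
      nlinarith [mul_nonneg hτ.le (neg_nonneg.2 h0)]
    linarith [hw0 x t h0]
  · intro p hp x
    have h0 : -T ≤ 0 := hab.trans ht₀
    have h1 := hkey p hp x (-T) h0
    have h4 : c * (3 / 4 * (τ * T)) ≤
        c * (a₀ / 8 * ‖x‖ ^ 2 + 15 / 16 * τ * -(-T) - τ * T / 8) := by
      refine mul_le_mul_of_nonneg_left ?_ hc0.le
      nlinarith [mul_pos hτ hT0, mul_nonneg ha₀.le (sq_nonneg ‖x‖)]
    linarith [hw0 x (-T) h0]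
  · intro p hp
    refine ⟨x₀, ?_⟩
    have h1 : -inner ℝ p x₀ ≤ κ * c * N * ‖x₀‖ := by
      rw [← inner_neg_left]
      refine (real_inner_le_norm _ _).trans ?_
      rw [norm_neg]
      gcongr
    have h2 : c * (u x₀ t₀ + κ * N * ‖x₀‖) ≤ c * (τ * T / 4) := by
      refine mul_le_mul_of_nonneg_left ?_ hc0.le
      have h3 : N * (4 * (|u x₀ t₀| + κ * ‖x₀‖)) ≤ N * (N * τ) :=
        mul_le_mul_of_nonneg_left hNu hN0.le
      nlinarith [le_abs_self (u x₀ t₀), abs_nonneg (u x₀ t₀)]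
    linarith
  · intro p hp t ht x hx hlt
    have h0 := ht.2.le.trans ht₀
    have h1 := hkey p hp x t h0
    have h4 : c * (-(τ * T) / 8) ≤
        c * (a₀ / 8 * ‖x‖ ^ 2 + 15 / 16 * τ * -t - τ * T / 8) := by
      refine mul_le_mul_of_nonneg_left ?_ hc0.le
      nlinarith [mul_nonneg ha₀.le (sq_nonneg ‖x‖), mul_nonneg hτ.le (neg_nonneg.2 h0)]
    refine ⟨hx, ⟨ht.1, h0⟩, ?_⟩
    have h5 : 0 < c * (τ * T) := by positivity
    simp only at hlt ⊢
    linarith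
  · intro x t ht hpsd hle
    have h0 := ht.2.le.trans ht₀
    have hps : (c • D x t + wH x t).PosSemidef := by
      refine Matrix.PosSemidef.of_dotProduct_mulVec_nonneg ?_ fun v => ?_
      · exact ((hS.posDef x t h0).isHermitian.smul (IsSelfAdjoint.all c)).add (hsymm x t h0)
      · have h := hpsd (WithLp.toLp 2 v)
        rw [inner_toEuclideanCLM] at h
        simpa using h
    rw [det_toEuclideanCLM, abs_of_nonneg hps.det_nonneg]
    exact hdet c hc0 hc1 x t h0 hps hle

section UnitTimeDifference

variable {n : ℕ} {u g : En n → ℝ → ℝ} {G : En n → ℝ → En n}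
  {D : En n → ℝ → Matrix (Fin n) (Fin n) ℝ} {f₁ : En n → ℝ} {f₂ : ℝ → ℝ} {m₁ m₂ : ℝ}

theorem ParabolicSolution.continuousOn_shift (hS : ParabolicSolution u g G D f₁ f₂ m₁ m₂) :
    ContinuousOn (fun q : En n × ℝ => u q.1 (q.2 - 1)) (univ ×ˢ Iic 0) := by
  refine hS.continuousOn.comp (f := fun q : En n × ℝ => (q.1, q.2 - 1)) (by fun_prop) ?_
  rintro ⟨x, t⟩ ⟨-, ht⟩
  simp only [mem_Iic] at ht
  exact ⟨mem_univ _, by simp only [mem_Iic]; linarith⟩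

theorem ParabolicSolution.hasDerivAt_shift (hS : ParabolicSolution u g G D f₁ f₂ m₁ m₂)
    (x : En n) {t : ℝ} (ht : t ≤ 0) : HasDerivAt (fun s => u x (s - 1)) (-g x (t - 1)) t :=
  (hS.hasDerivAt x (t - 1) (by linarith)).comp_sub_const t 1

theorem ParabolicSolution.abs_speed_sub_le (hS : ParabolicSolution u g G D f₁ f₂ m₁ m₂)
    (x : En n) {s t : ℝ} (hs : s ≤ 0) (ht : t ≤ 0) : |g x s - g x t| ≤ m₂ := by
  have h1 := hS.le_speed x s hs
  have h2 := hS.le_speed x t ht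
  have h3 := hS.speed_le x s hs
  have h4 := hS.speed_le x t ht
  have h5 := hS.speed_pos
  rw [abs_le]
  constructor <;> linarith

variable {a₀ τ C₁ κ K Λ δ : ℝ}

/-- Near-maximality of the unit time difference at a point propagates to a set of definite
density. -/
theorem ParabolicSolution.le_volume_near_sup (hS : ParabolicSolution u g G D f₁ f₂ m₁ m₂)
    (ha₀ : 0 < a₀) (hτ : 0 < τ) (hκ : 0 < κ) (hκ2 : 32 * κ ^ 2 = a₀ * τ) (hK : 0 < K)
    (hK2 : 8 * τ ≤ a₀ * K ^ 2) (hΛ : 0 < Λ) (hδ : 0 < δ)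
    (hlow : ∀ x, ∀ t ≤ 0, a₀ / 4 * ‖x‖ ^ 2 + 15 / 16 * τ * -t - C₁ ≤ u x t)
    (hper : ∀ t ≤ 0, f₂ (t - 1) = f₂ t)
    (hf : ∀ x, ∀ t ≤ 0, 0 < f₁ x * f₂ t ∧ f₁ x * f₂ t ≤ Λ) {M : ℝ}
    (hM : ∀ x, ∀ t ≤ 0, u x (t - 1) - u x t ≤ M) {x₀ : En n} {t₀ : ℝ} (ht₀ : t₀ ≤ 0)
    (h₀ : M - δ ≤ u x₀ (t₀ - 1) - u x₀ t₀) :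
    ∀ᶠ N : ℕ in Filter.atTop, ENNReal.ofReal (densityConst n τ Λ κ * (N : ℝ) ^ (n + 2)) ≤
      volume {q : En n × ℝ | ‖q.1‖ < K * N ∧ q.2 ∈ Ioc (-(N : ℝ) ^ 2) 0 ∧
        M - 4 * δ ≤ u q.1 (q.2 - 1) - u q.1 q.2} := by
  have hsub : ∀ t : ℝ, t ≤ 0 → t - 1 ≤ 0 := fun t ht => by linarith
  have key := le_volume_sublevel hS ha₀ hτ hκ hκ2 hK hK2 hΛ hδ hlow
    (w := fun x t => M + u x t - u x (t - 1)) (w' := fun x t => -g x t - -g x (t - 1))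
    (wG := fun x t => G x t - G x (t - 1)) (wH := fun x t => D x t - D x (t - 1)) (C := m₂)
    (fun x t ht => by linarith [hM x t ht])
    ((hS.continuousOn.const_add M).sub hS.continuousOn_shift)
    (fun x t ht => ((hS.hasDerivAt x t ht).const_add M).sub (hS.hasDerivAt_shift x ht))
    (fun x t ht => by
      have := hS.abs_speed_sub_le x (hsub t ht) ht
      rwa [show -g x t - -g x (t - 1) = g x (t - 1) - g x t by ring])
    (fun x t ht => by
      rw [hasGradientAt_iff_hasFDerivAt, map_sub]
      exact ((hS.hasGradientAt x t ht).hasFDerivAt.const_add M).sub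
        (hS.hasGradientAt x (t - 1) (hsub t ht)).hasFDerivAt)
    (fun x t ht => by
      rw [map_sub]
      exact (hS.hasFDerivAt x t ht).sub (hS.hasFDerivAt x (t - 1) (hsub t ht)))
    (fun c hc0 hc1 x t ht hps hle => by
      have h1 := hS.eqn x (t - 1) (hsub t ht)
      rw [hper t ht] at h1
      have h2 := hS.eqn x t ht
      have h := mul_det_le_of_mul_det_add_eq (hS.posDef x (t - 1) (hsub t ht)) hps
        (p := g x (t - 1)) (z := -(c * -g x t + (-g x t - -g x (t - 1)))) (a := 1) (b := 1 + c)
        (hS.speed_pos.trans_le (hS.le_speed x _ (hsub t ht))) (by linarith) one_pos (by linarith)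
        (hf x t ht).1 (by rw [h1]; simp) (by
          rw [show D x (t - 1) + (c • D x t + (D x t - D x (t - 1))) = (1 + c) • D x t by
            rw [add_smul, one_smul]; abel, Matrix.det_smul, Fintype.card_fin, ← h2]
          ring)
      refine h.trans ?_
      rw [add_sub_cancel_left]
      exact mul_le_mul_of_nonneg_left (hf x t ht).2 (by positivity))
    (fun x t ht => (hS.posDef x t ht).isHermitian.sub (hS.posDef x _ (hsub t ht)).isHermitian)
    ht₀ (by linarith : M + u x₀ t₀ - u x₀ (t₀ - 1) ≤ δ)
  filter_upwards [key] with N hN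
  refine hN.trans (measure_mono ?_)
  rintro q ⟨h1, h2, h3⟩
  exact ⟨h1, h2, by linarith⟩

/-- Near-minimality of the unit time difference at a point propagates to a set of definite
density. -/
theorem ParabolicSolution.le_volume_near_inf (hS : ParabolicSolution u g G D f₁ f₂ m₁ m₂)
    (ha₀ : 0 < a₀) (hτ : 0 < τ) (hκ : 0 < κ) (hκ2 : 32 * κ ^ 2 = a₀ * τ) (hK : 0 < K)
    (hK2 : 8 * τ ≤ a₀ * K ^ 2) (hΛ : 0 < Λ) (hδ : 0 < δ)
    (hlow : ∀ x, ∀ t ≤ 0, a₀ / 4 * ‖x‖ ^ 2 + 15 / 16 * τ * -t - C₁ ≤ u x t)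
    (hper : ∀ t ≤ 0, f₂ (t - 1) = f₂ t)
    (hf : ∀ x, ∀ t ≤ 0, 0 < f₁ x * f₂ t ∧ f₁ x * f₂ t ≤ Λ) {m : ℝ}
    (hm : ∀ x, ∀ t ≤ 0, m ≤ u x (t - 1) - u x t) {x₀ : En n} {t₀ : ℝ} (ht₀ : t₀ ≤ 0)
    (h₀ : u x₀ (t₀ - 1) - u x₀ t₀ ≤ m + δ) :
    ∀ᶠ N : ℕ in Filter.atTop, ENNReal.ofReal (densityConst n τ Λ κ * (N : ℝ) ^ (n + 2)) ≤
      volume {q : En n × ℝ | ‖q.1‖ < K * N ∧ q.2 ∈ Ioc (-(N : ℝ) ^ 2) 0 ∧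
        u q.1 (q.2 - 1) - u q.1 q.2 ≤ m + 4 * δ} := by
  have hsub : ∀ t : ℝ, t ≤ 0 → t - 1 ≤ 0 := fun t ht => by linarith
  have key := le_volume_sublevel hS ha₀ hτ hκ hκ2 hK hK2 hΛ hδ hlow
    (w := fun x t => -m + u x (t - 1) - u x t) (w' := fun x t => -g x (t - 1) - -g x t)
    (wG := fun x t => G x (t - 1) - G x t) (wH := fun x t => D x (t - 1) - D x t) (C := m₂)
    (fun x t ht => by linarith [hm x t ht])
    ((hS.continuousOn_shift.const_add (-m)).sub hS.continuousOn)
    (fun x t ht => ((hS.hasDerivAt_shift x ht).const_add (-m)).sub (hS.hasDerivAt x t ht))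
    (fun x t ht => by
      have := hS.abs_speed_sub_le x ht (hsub t ht)
      rwa [show -g x (t - 1) - -g x t = g x t - g x (t - 1) by ring])
    (fun x t ht => by
      rw [hasGradientAt_iff_hasFDerivAt, map_sub]
      exact ((hS.hasGradientAt x (t - 1) (hsub t ht)).hasFDerivAt.const_add (-m)).sub
        (hS.hasGradientAt x t ht).hasFDerivAt)
    (fun x t ht => by
      rw [map_sub]
      exact (hS.hasFDerivAt x (t - 1) (hsub t ht)).sub (hS.hasFDerivAt x t ht))
    (fun c hc0 hc1 x t ht hps hle => by
      have h1 := hS.eqn x (t - 1) (hsub t ht)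
      rw [hper t ht] at h1
      have h2 := hS.eqn x t ht
      have h := mul_det_le_of_mul_det_add_eq ((hS.posDef x t ht).smul (sub_pos.2 hc1)) hps
        (p := (1 - c) * g x t) (z := -(c * -g x t + (-g x (t - 1) - -g x t))) (a := 1 - c) (b := 1)
        (mul_pos (sub_pos.2 hc1) (hS.speed_pos.trans_le (hS.le_speed x _ ht))) (by linarith)
        (sub_pos.2 hc1) one_pos (hf x t ht).1
        (by
          rw [Matrix.det_smul, Fintype.card_fin, ← h2]
          ring) (by
          rw [show (1 - c) • D x t + (c • D x t + (D x (t - 1) - D x t)) = D x (t - 1) by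
            rw [sub_smul, one_smul]; abel, ← h1]
          ring)
      refine h.trans ?_
      rw [sub_sub_cancel]
      exact mul_le_mul_of_nonneg_left (hf x t ht).2 (by positivity))
    (fun x t ht => (hS.posDef x _ (hsub t ht)).isHermitian.sub (hS.posDef x t ht).isHermitian)
    ht₀ (by linarith : -m + u x₀ (t₀ - 1) - u x₀ t₀ ≤ δ)
  filter_upwards [key] with N hN
  refine hN.trans (measure_mono ?_)
  rintro q ⟨h1, h2, h3⟩
  exact ⟨h1, h2, by linarith⟩

end UnitTimeDifference

/-- The half-open coordinate cube `[-R, R)ⁿ`. -/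
def centeredBox (n : ℕ) (R : ℝ) : Set (En n) := {x | ∀ i, x i ∈ Ico (-R) R}

theorem centeredBox_eq_preimage (n : ℕ) (R : ℝ) :
    centeredBox n R = (WithLp.ofLp : En n → Fin n → ℝ) ⁻¹' (univ.pi fun _ => Ico (-R) R) := by
  ext x; simp [centeredBox]

theorem measurableSet_centeredBox (n : ℕ) (R : ℝ) : MeasurableSet (centeredBox n R) := by
  rw [centeredBox_eq_preimage]
  exact (PiLp.volume_preserving_ofLp (Fin n)).measurable
    (MeasurableSet.univ_pi fun _ => measurableSet_Ico)

theorem volume_centeredBox {n : ℕ} {R : ℝ} (hR : 0 ≤ R) :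
    volume (centeredBox n R) = ENNReal.ofReal ((2 * R) ^ n) := by
  rw [centeredBox_eq_preimage, (PiLp.volume_preserving_ofLp (Fin n)).measure_preimage
    (MeasurableSet.univ_pi fun _ => measurableSet_Ico).nullMeasurableSet, Real.volume_pi_Ico]
  simp only [sub_neg_eq_add, Finset.prod_const, Finset.card_univ, Fintype.card_fin]
  rw [← ENNReal.ofReal_pow (by linarith), two_mul]

theorem norm_le_of_mem_centeredBox {n : ℕ} {R : ℝ} {x : En n} (hx : x ∈ centeredBox n R) :
    ‖x‖ ≤ n * R := by
  have h : ∀ i, ‖x i‖ ≤ R := fun i => by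
    rw [Real.norm_eq_abs, abs_le]; exact ⟨(hx i).1, (hx i).2.le⟩
  have h1 : ‖x‖ ≤ ∑ i, ‖x i‖ := by
    calc ‖x‖ = ‖∑ i, x i • EuclideanSpace.single i (1:ℝ)‖ := by
          congr 1
          ext j
          simp [Pi.single_apply]
      _ ≤ ∑ i, ‖x i‖ := (norm_sum_le _ _).trans (by simp [norm_smul])
  calc ‖x‖ ≤ ∑ i, ‖x i‖ := h1
    _ ≤ ∑ _i : Fin n, R := Finset.sum_le_sum fun i _ => h i
    _ = n * R := by simp

theorem setIntegral_centeredBox_of_periodic {n : ℕ} {f : En n → ℝ} (hf : Continuous f)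
    (hper : ∀ (x : En n) (i : Fin n), f (x + EuclideanSpace.single i 1) = f x) (R : ℕ) :
    ∫ x in centeredBox n R, f x =
      (2 * R : ℝ) ^ n * ∫ x in {x : En n | ∀ i, x i ∈ Icc (0:ℝ) 1}, f x := by
  have hper1 : ∀ (i : Fin n) (m : ℤ) (x : En n),
      f (x + m • EuclideanSpace.single i (1:ℝ)) = f x := by
    intro i m x
    have : Function.Periodic f (EuclideanSpace.single i (1:ℝ)) := fun y => hper y i
    exact this.zsmul m x
  have hperk : ∀ (k : Fin n → ℤ) (x : En n), f (x + WithLp.toLp 2 fun i => (k i : ℝ)) = f x := by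
    intro k x
    have hs : (WithLp.toLp 2 fun i => (k i : ℝ) : En n) =
        ∑ i, k i • EuclideanSpace.single i (1:ℝ) := by
      ext j
      simp [Pi.single_apply]
    have hsum : ∀ s : Finset (Fin n), ∀ y : En n,
        f (y + ∑ i ∈ s, k i • EuclideanSpace.single i (1:ℝ)) = f y := by
      intro s
      induction s using Finset.induction_on with
      | empty => simp
      | insert i s hi ih =>
        intro y
        rw [Finset.sum_insert hi, ← add_assoc, ih, hper1]
    rw [hs, hsum]
  set P : (Fin n → ℤ) → Set (En n) := fun k => {x | ∀ i, ⌊x i⌋ = k i} with hP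
  have hPpre : ∀ k, P k = (WithLp.ofLp : En n → Fin n → ℝ) ⁻¹'
      (univ.pi fun i => Ico (k i : ℝ) (k i + 1)) := by
    intro k; ext x; simp [P, Int.floor_eq_iff]
  have hPm : ∀ k, MeasurableSet (P k) := fun k => by
    rw [hPpre]
    exact (PiLp.volume_preserving_ofLp (Fin n)).measurable
      (MeasurableSet.univ_pi fun _ => measurableSet_Ico)
  have hbox : centeredBox n R = ⋃ k ∈ Fintype.piFinset fun _ : Fin n => Finset.Ico (-(R:ℤ)) R,
      P k := by
    ext x
    simp only [centeredBox, mem_ofPred_eq, mem_iUnion, Fintype.mem_piFinset, Finset.mem_Ico, P,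
      exists_prop]
    constructor
    · intro h
      refine ⟨fun i => ⌊x i⌋, fun i => ⟨?_, ?_⟩, fun i => rfl⟩
      · rw [Int.le_floor]; push_cast; exact (h i).1
      · rw [Int.floor_lt]; exact_mod_cast (h i).2
    · rintro ⟨k, hk, hx⟩ i
      obtain ⟨h1, h2⟩ := hk i
      rw [← hx i] at h1 h2
      rw [Int.le_floor] at h1
      rw [Int.floor_lt] at h2
      push_cast at h1 h2
      exact ⟨h1, h2⟩
  have hunit : ∫ x in P 0, f x = ∫ x in {x : En n | ∀ i, x i ∈ Icc (0:ℝ) 1}, f x := by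
    refine setIntegral_congr_set ?_
    have h := Measure.univ_pi_Ico_ae_eq_Icc (μ := fun _ : Fin n => (volume : Measure ℝ))
      (f := fun _ => (0:ℝ)) (g := fun _ => 1)
    have h' := (PiLp.volume_preserving_ofLp (Fin n)).quasiMeasurePreserving.preimage_ae_eq h
    rw [hPpre]
    have h0 : (univ.pi fun i : Fin n => Ico (((0 : Fin n → ℤ) i : ℤ) : ℝ) (((0 : Fin n → ℤ) i : ℤ) + 1)) =
        univ.pi fun _ : Fin n => Ico (0:ℝ) 1 := by simp
    have h1 : {x : En n | ∀ i, x i ∈ Icc (0:ℝ) 1} =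
        (WithLp.ofLp : En n → Fin n → ℝ) ⁻¹' Icc (fun _ => 0) fun _ => 1 := by
      ext x; simp [Pi.le_def, forall_and]
    rw [h0, h1]
    exact h'
  have hpiece : ∀ k, ∫ x in P k, f x = ∫ x in P 0, f x := by
    intro k
    set e : En n := WithLp.toLp 2 fun i => (k i : ℝ) with he
    have hmp := measurePreserving_add_right (volume : Measure (En n)) e
    rw [← hmp.setIntegral_preimage_emb (measurableEmbedding_addRight e)]
    have : (fun x => x + e) ⁻¹' P k = P 0 := by
      ext x; simp [P, e]
    rw [this]
    exact integral_congr_ae (Filter.Eventually.of_forall fun x => hperk k x)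
  have hPint : ∀ k, IntegrableOn f (P k) := by
    intro k
    have hc : IsCompact ((WithLp.ofLp : En n → Fin n → ℝ) ⁻¹'
        (univ.pi fun i => Icc (k i : ℝ) (k i + 1))) :=
      (PiLp.homeomorph 2 (fun _ : Fin n => ℝ)).isCompact_preimage.2
        (isCompact_univ_pi fun _ => isCompact_Icc)
    refine (hf.continuousOn.integrableOn_compact hc).mono_set ?_
    rw [hPpre]
    exact preimage_mono (pi_mono fun i _ => Ico_subset_Icc_self)
  rw [hbox, integral_biUnion_finset _ (fun k _ => hPm k) ?_ fun k _ => hPint k]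
  · rw [Finset.sum_congr rfl fun k _ => (hpiece k).trans hunit, Finset.sum_const,
      Fintype.card_piFinset]
    simp only [Int.card_Ico, Finset.prod_const, Finset.card_univ, Fintype.card_fin, nsmul_eq_mul]
    congr 2
    rw [show (R:ℤ) - -R = ((2 * R : ℕ) : ℤ) by push_cast; ring, Int.toNat_natCast]
    push_cast
    ring
  · intro k _ l _ hkl
    rw [Function.onFun, Set.disjoint_left]
    intro x hx hx'
    exact hkl (funext fun i => (hx i).symm.trans (hx' i))

theorem intervalIntegral_of_periodic_nonpos {f : ℝ → ℝ} (hf : ContinuousOn f (Iic 0))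
    (hper : ∀ t ≤ 0, f (t - 1) = f t) (T : ℕ) :
    ∫ t in (-(T:ℝ))..0, f t = T * ∫ t in (-1:ℝ)..0, f t := by
  have hInt : ∀ a b : ℝ, a ≤ 0 → b ≤ 0 → IntervalIntegrable f volume a b := fun a b ha hb =>
    (hf.mono (by
      intro t ht
      rw [mem_uIcc] at ht
      simp only [mem_Iic]
      rcases ht with h | h <;> linarith)).intervalIntegrable
  have hunit : ∀ k : ℕ, ∫ t in (-((k:ℝ) + 1))..(-k), f t = ∫ t in (-1:ℝ)..0, f t := by
    intro k
    induction k with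
    | zero => simp
    | succ k ih =>
      rw [← ih]
      have h := intervalIntegral.integral_comp_sub_right (a := -((k:ℝ) + 1)) (b := -(k:ℝ)) f 1
      push_cast
      rw [show -((k:ℝ) + 1 + 1) = -((k:ℝ) + 1) - 1 by ring,
        show -((k:ℝ) + 1) = -(k:ℝ) - 1 by ring] at *
      rw [← h]
      refine intervalIntegral.integral_congr fun t ht => hper t ?_
      rw [uIcc_of_le (by linarith)] at ht
      linarith [ht.2, (Nat.cast_nonneg k : (0:ℝ) ≤ k)]
  induction T with
  | zero => simp
  | succ T ih =>
    have hT : (0:ℝ) ≤ T := Nat.cast_nonneg T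
    push_cast
    rw [← intervalIntegral.integral_add_adjacent_intervals (b := -(T:ℝ))
      (hInt _ _ (by linarith) (by linarith)) (hInt _ _ (by linarith) le_rfl), ih, hunit]
    ring

/-- `u` is asymptotic to the parabolic quadratic `½ xᵀAx - τt`. -/
def AsymptoticallyQuadratic {n : ℕ} (u : En n → ℝ → ℝ) (A : Matrix (Fin n) (Fin n) ℝ) (τ : ℝ) :
    Prop :=
  ∀ σ > 0, ∃ C, 0 ≤ C ∧ ∀ (x : En n) (t : ℝ), t ≤ 0 →
    |u x t - ((1 / 2) * PMA.quadForm A x - τ * t)| ≤ σ * (‖x‖ ^ 2 - t) + C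

section Asymptotics

variable {n : ℕ} {u g : En n → ℝ → ℝ} {G : En n → ℝ → En n}
  {D : En n → ℝ → Matrix (Fin n) (Fin n) ℝ} {f₁ : En n → ℝ} {f₂ : ℝ → ℝ} {m₁ m₂ τ : ℝ}
  {A : Matrix (Fin n) (Fin n) ℝ}

theorem AsymptoticallyQuadratic.eventually_abs_sub_le (hu : AsymptoticallyQuadratic u A τ)
    {B s : ℝ} (hB : 0 ≤ B) (hs : 0 < s) : ∀ᶠ N : ℕ in Filter.atTop, ∀ (x : En n) (t : ℝ), t ≤ 0 →
      ‖x‖ ≤ B * N → -t ≤ B * (N : ℝ) ^ 2 →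
      |u x t - ((1 / 2) * PMA.quadForm A x - τ * t)| ≤ s * (N : ℝ) ^ 2 := by
  obtain ⟨C, hC0, hC⟩ := hu (s / (2 * (B ^ 2 + B + 1))) (by positivity)
  filter_upwards [tendsto_natCast_atTop_atTop.eventually_ge_atTop (1:ℝ),
    tendsto_natCast_atTop_atTop.eventually_ge_atTop (2 * C / s)] with N hN1 hNC x t ht hx ht'
  rw [div_le_iff₀ hs] at hNC
  refine (hC x t ht).trans ?_
  have h1 : ‖x‖ ^ 2 - t ≤ (B ^ 2 + B + 1) * (N:ℝ) ^ 2 := by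
    have : ‖x‖ ^ 2 ≤ (B * N) ^ 2 := by gcongr
    nlinarith
  have h2 : s / (2 * (B ^ 2 + B + 1)) * (‖x‖ ^ 2 - t) ≤ s / 2 * (N:ℝ) ^ 2 := by
    calc _ ≤ s / (2 * (B ^ 2 + B + 1)) * ((B ^ 2 + B + 1) * (N:ℝ) ^ 2) := by gcongr
      _ = s / 2 * (N:ℝ) ^ 2 := by field_simp
  nlinarith

theorem quadForm_add (hA : A.IsSymm) (x v : En n) : PMA.quadForm A (x + v) =
    PMA.quadForm A x + 2 * inner ℝ (Matrix.toEuclideanCLM (𝕜 := ℝ) A x) v + PMA.quadForm A v := by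
  have h : inner ℝ x (Matrix.toEuclideanCLM (𝕜 := ℝ) A v) =
      inner ℝ v (Matrix.toEuclideanCLM (𝕜 := ℝ) A x) := by
    rw [inner_toEuclideanCLM, inner_toEuclideanCLM, Matrix.dotProduct_mulVec,
      ← Matrix.mulVec_transpose, hA.eq, dotProduct_comm]
  simp only [quadForm_eq_inner, map_add, inner_add_left, inner_add_right]
  rw [h, real_inner_comm v]
  ring

theorem quadForm_le (A : Matrix (Fin n) (Fin n) ℝ) (v : En n) :
    PMA.quadForm A v ≤ ‖Matrix.toEuclideanCLM (𝕜 := ℝ) A‖ * ‖v‖ ^ 2 := by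
  rw [quadForm_eq_inner]
  refine (real_inner_le_norm _ _).trans ?_
  nlinarith [(Matrix.toEuclideanCLM (𝕜 := ℝ) A).le_opNorm v, norm_nonneg v]

theorem ParabolicSolution.eventually_norm_gradient_sub_le
    (hS : ParabolicSolution u g G D f₁ f₂ m₁ m₂) (hu : AsymptoticallyQuadratic u A τ)
    (hA : A.IsSymm) {B s : ℝ} (hB : 0 ≤ B) (hs : 0 < s) :
    ∀ᶠ N : ℕ in Filter.atTop, ∀ (x : En n) (t : ℝ), t ≤ 0 →
      ‖x‖ ≤ B * N → -t ≤ B * (N : ℝ) ^ 2 →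
      ‖G x t - Matrix.toEuclideanCLM (𝕜 := ℝ) A x‖ ≤ s * N := by
  set a := ‖Matrix.toEuclideanCLM (𝕜 := ℝ) A‖
  have ha : 0 ≤ a := norm_nonneg _
  set ω := min 1 (s / (a + 1))
  have hω0 : 0 < ω := lt_min one_pos (by positivity)
  have hω1 : ω ≤ 1 := min_le_left _ _
  have hωa : ω * a ≤ s := by
    have h := min_le_right 1 (s / (a + 1))
    rw [le_div_iff₀ (by positivity)] at h
    nlinarith
  filter_upwards [hu.eventually_abs_sub_le (B := B + 1) (by positivity)
    (show 0 < ω * s / 4 by positivity),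
    tendsto_natCast_atTop_atTop.eventually_ge_atTop (1:ℝ)] with N hN hN1 x t ht hx ht'
  set e := G x t - Matrix.toEuclideanCLM (𝕜 := ℝ) A x with he
  rcases eq_or_ne e 0 with h0 | h0
  · rw [h0, norm_zero]; positivity
  have he0 : 0 < ‖e‖ := norm_pos_iff.2 h0
  set v := (ω * N / ‖e‖) • e with hv
  have hvn : ‖v‖ = ω * N := by
    rw [hv, norm_smul, Real.norm_of_nonneg (by positivity)]
    field_simp
  have hev : inner ℝ e v = ω * N * ‖e‖ := by
    rw [hv, inner_smul_right, real_inner_self_eq_norm_sq]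
    field_simp
  have hN2 : -t ≤ (B + 1) * (N:ℝ) ^ 2 := by nlinarith
  have h1 := hN x t ht (by nlinarith) hN2
  have h2 := hN (x + v) t ht ((norm_add_le _ _).trans (by rw [hvn]; nlinarith)) hN2
  have h3 := (hS.convexOn t ht).add_inner_le (hS.hasGradientAt x t ht) (x + v)
  rw [add_sub_cancel_left] at h3
  rw [quadForm_add hA] at h2
  have h4 := quadForm_le A v
  rw [hvn] at h4
  have h5 : inner ℝ (G x t) v = inner ℝ e v + inner ℝ (Matrix.toEuclideanCLM (𝕜 := ℝ) A x) v := by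
    rw [← inner_add_left, he, sub_add_cancel]
  rw [abs_le] at h1 h2
  have h6 : ω * N * ‖e‖ ≤ ω * N * (s * N) := by
    have h7 : a * (ω * N) ^ 2 ≤ s * (ω * N ^ 2) := by
      calc a * (ω * N) ^ 2 = (ω * a) * (ω * (N:ℝ) ^ 2) := by ring
        _ ≤ s * (ω * N ^ 2) := by gcongr
    nlinarith
  exact le_of_mul_le_mul_left h6 (by positivity)

theorem ParabolicSolution.gradient_injective (hS : ParabolicSolution u g G D f₁ f₂ m₁ m₂) {t : ℝ}
    (ht : t ≤ 0) : Function.Injective fun x => G x t := by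
  intro x y hxy
  by_contra hne
  have hv : y - x ≠ 0 := sub_ne_zero.2 (Ne.symm hne)
  have hline : ∀ s : ℝ, HasDerivAt (fun s : ℝ => x + s • (y - x)) (y - x) s := fun s => by
    simpa using ((hasDerivAt_id s).smul_const (y - x)).const_add x
  have hd : ∀ s : ℝ, HasDerivAt (fun s : ℝ => inner ℝ (y - x) (G (x + s • (y - x)) t))
      (inner ℝ (y - x) (Matrix.toEuclideanCLM (𝕜 := ℝ) (D (x + s • (y - x)) t) (y - x))) s := by
    intro s
    have a := (hS.hasFDerivAt (x + s • (y - x)) t ht).comp_hasDerivAt s (hline s)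
    exact (innerSL ℝ (y - x)).hasFDerivAt.comp_hasDerivAt s a
  obtain ⟨s, -, hs⟩ := exists_hasDerivAt_eq_slope _ _ (zero_lt_one' ℝ)
    (fun s _ => (hd s).continuousAt.continuousWithinAt) fun s _ => hd s
  have hpos := (hS.posDef (x + s • (y - x)) t ht).dotProduct_mulVec_pos
    (x := (y - x).ofLp) (by rwa [Ne, WithLp.ofLp_eq_zero])
  rw [inner_toEuclideanCLM] at hs
  simp only at hxy
  simp [hxy] at hs
  simp [hs] at hpos

theorem ParabolicSolution.setLIntegral_det_le (hS : ParabolicSolution u g G D f₁ f₂ m₁ m₂)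
    (hA : A.PosDef) {t R ς : ℝ} (ht : t ≤ 0) (hR : 0 ≤ R) (hς : 0 ≤ ς)
    (hG : ∀ x ∈ centeredBox n R, ‖G x t - Matrix.toEuclideanCLM (𝕜 := ℝ) A x‖ ≤ ς) :
    ∫⁻ x in centeredBox n R, ENNReal.ofReal (D x t).det ≤
      ENNReal.ofReal (A.det * (2 * (R + ‖Matrix.toEuclideanCLM (𝕜 := ℝ) A⁻¹‖ * ς)) ^ n) := by
  set b := ‖Matrix.toEuclideanCLM (𝕜 := ℝ) A⁻¹‖
  have hb : 0 ≤ b := norm_nonneg _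
  have hinv : ∀ x, Matrix.toEuclideanCLM (𝕜 := ℝ) A (Matrix.toEuclideanCLM (𝕜 := ℝ) A⁻¹ x) = x := by
    intro x
    rw [← mul_apply_eq_comp, ← map_mul,
      Matrix.mul_nonsing_inv _ hA.det_pos.ne'.isUnit, map_one, one_apply_eq_self]
  have hinv' : ∀ x, Matrix.toEuclideanCLM (𝕜 := ℝ) A⁻¹ (Matrix.toEuclideanCLM (𝕜 := ℝ) A x) = x := by
    intro x
    rw [← mul_apply_eq_comp, ← map_mul,
      Matrix.nonsing_inv_mul _ hA.det_pos.ne'.isUnit, map_one, one_apply_eq_self]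
  have himg : (fun x => G x t) '' centeredBox n R ⊆
      Matrix.toEuclideanCLM (𝕜 := ℝ) A '' centeredBox n (R + b * ς) := by
    rintro _ ⟨x, hx, rfl⟩
    refine ⟨Matrix.toEuclideanCLM (𝕜 := ℝ) A⁻¹ (G x t), fun i => ?_, hinv _⟩
    set e := Matrix.toEuclideanCLM (𝕜 := ℝ) A⁻¹ (G x t - Matrix.toEuclideanCLM (𝕜 := ℝ) A x) with he
    have h1 : Matrix.toEuclideanCLM (𝕜 := ℝ) A⁻¹ (G x t) = x + e := by
      rw [he, map_sub, hinv']; abel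
    have h2 : |e i| ≤ b * ς := by
      rw [← Real.norm_eq_abs]
      refine (PiLp.norm_apply_le e i).trans ((ContinuousLinearMap.le_opNorm _ _).trans ?_)
      gcongr
      exact hG x hx
    rw [abs_le] at h2
    rw [h1]
    have h3 := hx i
    simp only [PiLp.add_apply, mem_Ico] at h3 ⊢
    constructor <;> linarith
  calc ∫⁻ x in centeredBox n R, ENNReal.ofReal (D x t).det
      = ∫⁻ x in centeredBox n R,
          ENNReal.ofReal |(Matrix.toEuclideanCLM (𝕜 := ℝ) (D x t)).det| := by
        congr 1 with x
        rw [det_toEuclideanCLM, abs_of_pos (hS.posDef x t ht).det_pos]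
    _ = volume ((fun x => G x t) '' centeredBox n R) :=
        lintegral_abs_det_fderiv_eq_addHaar_image volume (measurableSet_centeredBox n R)
          (fun x _ => (hS.hasFDerivAt x t ht).hasFDerivWithinAt)
          (hS.gradient_injective ht).injOn
    _ ≤ volume (Matrix.toEuclideanCLM (𝕜 := ℝ) A '' centeredBox n (R + b * ς)) :=
        measure_mono himg
    _ = ENNReal.ofReal (A.det * (2 * (R + b * ς)) ^ n) := by
        rw [Measure.addHaar_image_continuousLinearMap, ← ContinuousLinearMap.det, det_toEuclideanCLM,
          abs_of_pos hA.det_pos, volume_centeredBox (by positivity),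
          ENNReal.ofReal_mul hA.det_pos.le]

end Asymptotics

section EnergyEstimate

variable {n : ℕ} {u g : En n → ℝ → ℝ} {G : En n → ℝ → En n}
  {D : En n → ℝ → Matrix (Fin n) (Fin n) ℝ} {f₁ : En n → ℝ} {f₂ : ℝ → ℝ} {m₁ m₂ τ : ℝ}
  {A : Matrix (Fin n) (Fin n) ℝ}

theorem integrableOn_centeredBox_prod {F : En n × ℝ → ℝ}
    (hF : ContinuousOn F (univ ×ˢ Iic 0)) (R T : ℝ) :
    IntegrableOn F (centeredBox n R ×ˢ Icc (-T) 0) := by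
  have hc : IsCompact (Metric.closedBall (0 : En n) (n * R) ×ˢ Icc (-T) 0) :=
    (isCompact_closedBall _ _).prod isCompact_Icc
  refine ((hF.mono (prod_mono (subset_univ _) Icc_subset_Iic_self)).integrableOn_compact
    hc).mono_set (prod_mono (fun x hx => ?_) le_rfl)
  simpa using norm_le_of_mem_centeredBox hx

theorem integrableOn_centeredBox {F : En n → ℝ} (hF : Continuous F) (R : ℝ) :
    IntegrableOn F (centeredBox n R) := by
  refine (hF.continuousOn.integrableOn_compact
    (isCompact_closedBall (0 : En n) (n * R))).mono_set fun x hx => ?_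
  simpa using norm_le_of_mem_centeredBox hx

theorem ParabolicSolution.setIntegral_speed (hS : ParabolicSolution u g G D f₁ f₂ m₁ m₂)
    (x : En n) {T : ℝ} (hT : 0 ≤ T) :
    ∫ t in Icc (-T) 0, g x t = u x (-T) - u x 0 := by
  rw [integral_Icc_eq_integral_Ioc, ← intervalIntegral.integral_of_le (by linarith)]
  have hle : ∀ t ∈ uIcc (-T) 0, t ≤ 0 := fun t ht => by
    rw [uIcc_of_le (by linarith)] at ht; exact ht.2
  have hc : ContinuousOn (fun t => -g x t) (uIcc (-T) 0) :=
    (hS.continuousOn_speed.comp (f := fun t => (x, t)) (by fun_prop)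
      fun t ht => ⟨mem_univ _, hle t ht⟩).neg
  have h := intervalIntegral.integral_eq_sub_of_hasDerivAt
    (fun t ht => hS.hasDerivAt x t (hle t ht)) hc.intervalIntegrable
  rw [intervalIntegral.integral_neg] at h
  linarith

theorem ParabolicSolution.setIntegral_sq_speed_sub_le
    (hS : ParabolicSolution u g G D f₁ f₂ m₁ m₂) (hApos : A.PosDef) (hdetA : τ * A.det = 1)
    (hτ : 0 < τ) (hf₁ : Continuous f₁) (hf₂ : ContinuousOn f₂ (Iic 0)) {ℓ : ℝ} (hℓ : 0 < ℓ)
    (hf₁ℓ : ∀ x, ℓ ≤ f₁ x) (hf₂pos : ∀ t ≤ 0, 0 < f₂ t)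
    (hper₁ : ∀ (x : En n) (i : Fin n), f₁ (x + EuclideanSpace.single i 1) = f₁ x)
    (hper₂ : ∀ t ≤ 0, f₂ (t - 1) = f₂ t)
    (havg₁ : ∫ x in {x : En n | ∀ i, x i ∈ Icc (0:ℝ) 1}, f₁ x = 1)
    (havg₂ : ∫ t in Icc (-1:ℝ) 0, f₂ t = 1) {R T : ℕ} {e ς : ℝ} (hς : 0 ≤ ς)
    (he : ∀ x ∈ centeredBox n R, u x (-T) - u x 0 ≤ τ * T + e)
    (hG : ∀ t ∈ Icc (-(T:ℝ)) 0, ∀ x ∈ centeredBox n R,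
      ‖G x t - Matrix.toEuclideanCLM (𝕜 := ℝ) A x‖ ≤ ς) :
    ℓ / (τ * m₂) * ∫ q in centeredBox n R ×ˢ Icc (-(T:ℝ)) 0, (g q.1 q.2 - τ * f₂ q.2) ^ 2 ≤
      (2 * R) ^ n * (e / τ) + T * ((2 * (R + ‖Matrix.toEuclideanCLM (𝕜 := ℝ) A⁻¹‖ * ς)) ^ n -
        (2 * R) ^ n) := by
  have hgpos : ∀ x, ∀ t ≤ 0, 0 < g x t := fun x t ht => hS.speed_pos.trans_le (hS.le_speed x t ht)
  have hm₂ : 0 < m₂ := (hgpos 0 0 le_rfl).trans_le (hS.speed_le 0 0 le_rfl)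
  have hf₁pos : ∀ x, 0 < f₁ x := fun x => hℓ.trans_le (hf₁ℓ x)
  set b := ‖Matrix.toEuclideanCLM (𝕜 := ℝ) A⁻¹‖
  set Q := centeredBox n R with hQ
  set I := Icc (-(T:ℝ)) 0 with hI
  have hT : (0:ℝ) ≤ T := Nat.cast_nonneg T
  have hQm : MeasurableSet Q := measurableSet_centeredBox n R
  have hc1 : ContinuousOn (fun q : En n × ℝ => f₁ q.1) (univ ×ˢ Iic 0) :=
    (hf₁.comp continuous_fst).continuousOn
  have hc2 : ContinuousOn (fun q : En n × ℝ => f₂ q.2) (univ ×ˢ Iic 0) :=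
    hf₂.comp continuous_snd.continuousOn fun q hq => hq.2
  have hcg := hS.continuousOn_speed
  have hcd : ContinuousOn (fun q : En n × ℝ => f₁ q.1 * f₂ q.2 / g q.1 q.2) (univ ×ˢ Iic 0) :=
    (hc1.mul hc2).div hcg fun q hq => (hgpos q.1 q.2 hq.2).ne'
  have hdet : ∀ x, ∀ t ≤ 0, f₁ x * f₂ t / g x t = (D x t).det := fun x t ht => by
    rw [← hS.eqn x t ht, mul_div_cancel_left₀ _ (hgpos x t ht).ne']
  have i0 : IntegrableOn (fun q : En n × ℝ => (g q.1 q.2 - τ * f₂ q.2) ^ 2) (Q ×ˢ I) :=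
    integrableOn_centeredBox_prod ((hcg.sub (hc2.const_mul τ)).pow 2) R T
  have i1 : IntegrableOn (fun q : En n × ℝ => f₁ q.1 * g q.1 q.2) (Q ×ˢ I) :=
    integrableOn_centeredBox_prod (hc1.mul hcg) R T
  have i2 : IntegrableOn (fun q : En n × ℝ => f₂ q.2 * (f₁ q.1 * f₂ q.2 / g q.1 q.2)) (Q ×ˢ I) :=
    integrableOn_centeredBox_prod (hc2.mul hcd) R T
  have i3 : IntegrableOn (fun q : En n × ℝ => f₁ q.1 * f₂ q.2) (Q ×ˢ I) :=
    integrableOn_centeredBox_prod (hc1.mul hc2) R T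
  have i12 : IntegrableOn (fun q : En n × ℝ => τ⁻¹ * (f₁ q.1 * g q.1 q.2) +
      τ * (f₂ q.2 * (f₁ q.1 * f₂ q.2 / g q.1 q.2))) (Q ×ˢ I) :=
    (i1.const_mul _).add (i2.const_mul _)
  have hf₁Q : ∫ x in Q, f₁ x = (2 * R) ^ n := by
    rw [hQ, setIntegral_centeredBox_of_periodic hf₁ hper₁ R, havg₁, mul_one]
  have hf₂I : ∫ t in I, f₂ t = T := by
    rw [hI, integral_Icc_eq_integral_Ioc, ← intervalIntegral.integral_of_le (by linarith),
      intervalIntegral_of_periodic_nonpos hf₂ hper₂, intervalIntegral.integral_of_le (by norm_num),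
      ← integral_Icc_eq_integral_Ioc, havg₂, mul_one]
  have e3 : ∫ q in Q ×ˢ I, f₁ q.1 * f₂ q.2 = (2 * R) ^ n * T := by
    rw [Measure.volume_eq_prod, setIntegral_prod_mul, hf₁Q, hf₂I]
  have e1 : ∫ q in Q ×ˢ I, f₁ q.1 * g q.1 q.2 ≤ (2 * R) ^ n * (τ * T + e) := by
    rw [Measure.volume_eq_prod, setIntegral_prod _ i1]
    simp only [integral_const_mul, hI, hS.setIntegral_speed _ hT]
    rw [← hf₁Q, ← integral_mul_const]
    refine setIntegral_mono_on ?_ ((integrableOn_centeredBox hf₁ R).mul_const _) hQm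
      fun x hx => mul_le_mul_of_nonneg_left (he x hx) (hf₁pos x).le
    have hcont : ∀ s ≤ (0:ℝ), Continuous fun x => u x s := fun s hs =>
      continuous_iff_continuousAt.2 fun x => (hS.hasGradientAt x s hs).hasFDerivAt.continuousAt
    exact integrableOn_centeredBox (hf₁.mul ((hcont _ (by linarith)).sub (hcont 0 le_rfl))) R
  have e2 : ∫ q in Q ×ˢ I, f₂ q.2 * (f₁ q.1 * f₂ q.2 / g q.1 q.2) ≤
      T * (A.det * (2 * (R + b * ς)) ^ n) := by
    have i2' : Integrable (fun q : En n × ℝ => f₂ q.2 * (f₁ q.1 * f₂ q.2 / g q.1 q.2))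
        ((volume.restrict Q).prod (volume.restrict I)) := by
      rw [Measure.prod_restrict]; exact i2
    rw [Measure.volume_eq_prod, ← Measure.prod_restrict, integral_prod_symm _ i2']
    have hf₂int : IntegrableOn f₂ I :=
      (hf₂.mono Icc_subset_Iic_self).integrableOn_compact isCompact_Icc
    rw [← hf₂I, ← integral_mul_const]
    refine setIntegral_mono_on i2'.integral_prod_right (hf₂int.mul_const _) measurableSet_Icc
      fun t ht => ?_
    simp only [integral_const_mul]
    refine mul_le_mul_of_nonneg_left ?_ (hf₂pos t ht.2).le
    have hct : Continuous fun x => f₁ x * f₂ t / g x t := by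
      rw [← continuousOn_univ]
      exact hcd.comp (f := fun x => (x, t)) (by fun_prop) fun x _ => ⟨mem_univ _, ht.2⟩
    rw [← ENNReal.ofReal_le_ofReal_iff (by have := hApos.det_pos; positivity),
      ofReal_integral_eq_lintegral_ofReal (integrableOn_centeredBox hct R)
        (Filter.Eventually.of_forall fun x => by
          simp only [hdet x t ht.2]
          exact (hS.posDef x t ht.2).det_pos.le)]
    simp only [hdet _ t ht.2]
    exact hS.setLIntegral_det_le hApos ht.2 (Nat.cast_nonneg R) hς (hG t ht)
  have hmono : ∫ q in Q ×ˢ I, ℓ / (τ * m₂) * (g q.1 q.2 - τ * f₂ q.2) ^ 2 ≤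
      ∫ q in Q ×ˢ I, (τ⁻¹ * (f₁ q.1 * g q.1 q.2) + τ * (f₂ q.2 * (f₁ q.1 * f₂ q.2 / g q.1 q.2)) -
        2 * (f₁ q.1 * f₂ q.2)) := by
    refine setIntegral_mono_on (i0.const_mul _) (i12.sub (i3.const_mul _)) (hQm.prod measurableSet_Icc) fun q hq => ?_
    have hg := hgpos q.1 q.2 hq.2.2
    have hid : τ⁻¹ * (f₁ q.1 * g q.1 q.2) + τ * (f₂ q.2 * (f₁ q.1 * f₂ q.2 / g q.1 q.2)) -
        2 * (f₁ q.1 * f₂ q.2) = f₁ q.1 / (τ * g q.1 q.2) * (g q.1 q.2 - τ * f₂ q.2) ^ 2 := by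
      field_simp
      ring
    rw [hid]
    have h1 := hf₁ℓ q.1
    have h2 := hS.speed_le q.1 q.2 hq.2.2
    have h3 := hf₁pos q.1
    gcongr
  rw [integral_const_mul, integral_sub i12 (i3.const_mul _),
    integral_add (i1.const_mul _) (i2.const_mul _), integral_const_mul, integral_const_mul,
    integral_const_mul, e3] at hmono
  refine hmono.trans ?_
  have e1' := mul_le_mul_of_nonneg_left e1 (inv_nonneg.2 hτ.le)
  have e2' := mul_le_mul_of_nonneg_left e2 hτ.le
  have h1 : τ⁻¹ * ((2 * R) ^ n * (τ * T + e)) = (2 * R) ^ n * T + (2 * R) ^ n * (e / τ) := by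
    field_simp
  have h2 : τ * (T * (A.det * (2 * (R + b * ς)) ^ n)) = T * (2 * (R + b * ς)) ^ n := by
    rw [show τ * (T * (A.det * (2 * (R + b * ς)) ^ n)) =
      (τ * A.det) * (T * (2 * (R + b * ς)) ^ n) by ring, hdetA, one_mul]
  rw [h1] at e1'
  rw [h2] at e2'
  linarith

theorem ParabolicSolution.eventually_setIntegral_sq_speed_sub_le
    (hS : ParabolicSolution u g G D f₁ f₂ m₁ m₂) (hu : AsymptoticallyQuadratic u A τ)
    (hA : A.IsSymm) (hApos : A.PosDef) (hdetA : τ * A.det = 1)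
    (hτ : 0 < τ) (hf₁ : Continuous f₁) (hf₂ : ContinuousOn f₂ (Iic 0)) {ℓ : ℝ} (hℓ : 0 < ℓ)
    (hf₁ℓ : ∀ x, ℓ ≤ f₁ x) (hf₂pos : ∀ t ≤ 0, 0 < f₂ t)
    (hper₁ : ∀ (x : En n) (i : Fin n), f₁ (x + EuclideanSpace.single i 1) = f₁ x)
    (hper₂ : ∀ t ≤ 0, f₂ (t - 1) = f₂ t)
    (havg₁ : ∫ x in {x : En n | ∀ i, x i ∈ Icc (0:ℝ) 1}, f₁ x = 1)
    (havg₂ : ∫ t in Icc (-1:ℝ) 0, f₂ t = 1) (K : ℕ) {η : ℝ} (hη : 0 < η) :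
    ∀ᶠ N : ℕ in Filter.atTop,
      ∫ q in centeredBox n (K * N) ×ˢ Icc (-((N:ℝ) ^ 2 + 1)) 0, (g q.1 q.2 - τ * f₂ q.2) ^ 2 ≤
        η * (N:ℝ) ^ (n + 2) := by
  have hm₂ : 0 < m₂ :=
    hS.speed_pos.trans_le ((hS.le_speed 0 0 le_rfl).trans (hS.speed_le 0 0 le_rfl))
  set b := ‖Matrix.toEuclideanCLM (𝕜 := ℝ) A⁻¹‖
  have hb : 0 ≤ b := norm_nonneg _
  set ν := ℓ / (τ * m₂) with hν
  have hν0 : 0 < ν := by positivity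
  obtain ⟨s, hs0, hs⟩ : ∃ s > 0, (2 * (K:ℝ)) ^ n * (2 * s / τ) +
      2 * ((2 * (K + b * s)) ^ n - (2 * K) ^ n) < ν * η := by
    have hc : Continuous fun s : ℝ => (2 * (K:ℝ)) ^ n * (2 * s / τ) +
      2 * ((2 * (K + b * s)) ^ n - (2 * K) ^ n) := by fun_prop
    have h0 : ∀ᶠ s in nhds (0:ℝ), (2 * (K:ℝ)) ^ n * (2 * s / τ) +
        2 * ((2 * (K + b * s)) ^ n - (2 * K) ^ n) < ν * η := by
      refine hc.continuousAt.eventually_lt continuousAt_const ?_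
      simpa using mul_pos hν0 hη
    exact ((h0.filter_mono nhdsWithin_le_nhds).and (self_mem_nhdsWithin (s := Ioi (0:ℝ)))).exists.imp
      fun s hs => ⟨hs.2, hs.1⟩
  have hB : (0:ℝ) ≤ n * K + 2 := by positivity
  filter_upwards [hu.eventually_abs_sub_le hB hs0, hS.eventually_norm_gradient_sub_le hu hA hB hs0,
    tendsto_natCast_atTop_atTop.eventually_ge_atTop (1:ℝ)] with N h1 h2 hN
  have hN2 : (1:ℝ) ≤ (N:ℝ) ^ 2 := one_le_pow₀ hN
  have hnK : (0:ℝ) ≤ n * K := by positivity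
  have hx : ∀ x ∈ centeredBox n ((K * N : ℕ):ℝ), ‖x‖ ≤ (n * K + 2) * N := fun x hx => by
    have := norm_le_of_mem_centeredBox hx
    push_cast at this
    nlinarith
  have ht : (N:ℝ) ^ 2 + 1 ≤ (n * K + 2) * (N:ℝ) ^ 2 := by nlinarith
  have h := hS.setIntegral_sq_speed_sub_le hApos hdetA hτ hf₁ hf₂ hℓ hf₁ℓ hf₂pos hper₁ hper₂ havg₁
    havg₂ (R := K * N) (T := N ^ 2 + 1) (e := 2 * s * (N:ℝ) ^ 2) (ς := s * N) (by positivity)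
    (fun x hxQ => by
      have a1 := abs_le.1 (h1 x (-((N ^ 2 + 1 : ℕ):ℝ)) (by push_cast; linarith) (hx x hxQ)
        (by push_cast; linarith))
      have a2 := abs_le.1 (h1 x 0 le_rfl (hx x hxQ) (by linarith))
      linarith [a1.2, a2.1])
    (fun t htI x hxQ => h2 x t htI.2 (hx x hxQ) (by
      have := htI.1
      push_cast at this
      linarith))
  push_cast at h
  have hscale : (2 * (K * N + b * (s * N))) ^ n = (2 * (K + b * s)) ^ n * (N:ℝ) ^ n := by
    rw [← mul_pow]; ring
  have hscale' : (2 * (K * N) : ℝ) ^ n = (2 * K) ^ n * (N:ℝ) ^ n := by rw [← mul_pow]; ring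
  rw [hscale, hscale', ← hν] at h
  have hmono : (2 * (K:ℝ)) ^ n ≤ (2 * (K + b * s)) ^ n := by
    gcongr
    have := mul_nonneg hb hs0.le
    linarith
  refine le_of_mul_le_mul_left (h.trans ?_) hν0
  calc (2 * (K:ℝ)) ^ n * (N:ℝ) ^ n * (2 * s * (N:ℝ) ^ 2 / τ) +
        ((N:ℝ) ^ 2 + 1) * ((2 * (K + b * s)) ^ n * (N:ℝ) ^ n - (2 * K) ^ n * (N:ℝ) ^ n)
      = (2 * (K:ℝ)) ^ n * (2 * s / τ) * (N:ℝ) ^ (n + 2) +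
        ((N:ℝ) ^ 2 + 1) * (((2 * (K + b * s)) ^ n - (2 * K) ^ n) * (N:ℝ) ^ n) := by ring
    _ ≤ (2 * (K:ℝ)) ^ n * (2 * s / τ) * (N:ℝ) ^ (n + 2) +
        (2 * (N:ℝ) ^ 2) * (((2 * (K + b * s)) ^ n - (2 * K) ^ n) * (N:ℝ) ^ n) := by
      have := sub_nonneg.2 hmono
      gcongr
      linarith
    _ = ((2 * (K:ℝ)) ^ n * (2 * s / τ) + 2 * ((2 * (K + b * s)) ^ n - (2 * K) ^ n)) *
        (N:ℝ) ^ (n + 2) := by ring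
    _ ≤ ν * η * (N:ℝ) ^ (n + 2) := by gcongr
    _ = ν * (η * (N:ℝ) ^ (n + 2)) := by ring

end EnergyEstimate

section Averages

theorem sq_intervalIntegral_unit_le {h : ℝ → ℝ} (hh : Continuous h) (t : ℝ) :
    (∫ s in (t - 1)..t, h s) ^ 2 ≤ ∫ s in (t - 1)..t, h s ^ 2 := by
  set c := ∫ s in (t - 1)..t, h s with hc
  have h0 : 0 ≤ ∫ s in (t - 1)..t, (h s - c) ^ 2 :=
    intervalIntegral.integral_nonneg (by linarith) fun s _ => sq_nonneg _
  have h1 : ∫ s in (t - 1)..t, (h s - c) ^ 2 =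
      (∫ s in (t - 1)..t, h s ^ 2) - c ^ 2 := by
    have e : ∀ s, (h s - c) ^ 2 = h s ^ 2 - 2 * c * h s + c ^ 2 := fun s => by ring
    simp only [e]
    rw [intervalIntegral.integral_add ((by fun_prop : Continuous _).intervalIntegrable _ _)
      ((by fun_prop : Continuous _).intervalIntegrable _ _),
      intervalIntegral.integral_sub ((by fun_prop : Continuous _).intervalIntegrable _ _)
      ((by fun_prop : Continuous _).intervalIntegrable _ _), intervalIntegral.integral_const_mul,
      intervalIntegral.integral_const, ← hc, smul_eq_mul]
    ring
  linarith

/-- Averaging over unit intervals does not increase the `L²` norm. -/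
theorem intervalIntegral_sq_average_le {h : ℝ → ℝ} (hh : Continuous h) {T : ℝ} (hT : 0 ≤ T) :
    ∫ t in (-T)..0, (∫ s in (t - 1)..t, h s) ^ 2 ≤ ∫ s in (-(T + 1))..0, h s ^ 2 := by
  have hi : ∀ a b, IntervalIntegrable h volume a b := fun a b => hh.intervalIntegrable a b
  have hi2 : ∀ a b, IntervalIntegrable (fun s => h s ^ 2) volume a b := fun a b =>
    (hh.pow 2).intervalIntegrable a b
  set H : ℝ → ℝ := fun t => ∫ s in (0:ℝ)..t, h s ^ 2 with hH
  have hHc : Continuous H := intervalIntegral.continuous_primitive hi2 0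
  have hdiff : ∀ a b, ∫ s in a..b, h s ^ 2 = H b - H a := fun a b =>
    (intervalIntegral.integral_interval_sub_left (hi2 _ _) (hi2 _ _)).symm
  have hmono : ∀ a b, a ≤ b → H a ≤ H b := fun a b hab => by
    have := intervalIntegral.integral_nonneg (μ := volume) hab fun s (_ : s ∈ Icc a b) => sq_nonneg (h s)
    rw [hdiff] at this
    linarith
  have hH0 : H 0 = 0 := by simp [hH]
  have hHi : ∀ a b, IntervalIntegrable H volume a b := fun a b => hHc.intervalIntegrable a b
  have hcav : Continuous fun t => ∫ s in (t - 1)..t, h s := by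
    have hp := intervalIntegral.continuous_primitive hi 0
    have e : (fun t => ∫ s in (t - 1)..t, h s) =
        fun t => (∫ s in (0:ℝ)..t, h s) - ∫ s in (0:ℝ)..(t - 1), h s := by
      funext t
      rw [intervalIntegral.integral_interval_sub_left (hi _ _) (hi _ _)]
    rw [e]
    exact hp.sub (hp.comp (continuous_sub_right 1))
  have hHs : IntervalIntegrable (fun t => H (t - 1)) volume (-T) 0 :=
    (hHc.comp (continuous_sub_right 1)).intervalIntegrable _ _
  calc ∫ t in (-T)..0, (∫ s in (t - 1)..t, h s) ^ 2
      ≤ ∫ t in (-T)..0, (H t - H (t - 1)) :=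
        intervalIntegral.integral_mono_on (by linarith) ((hcav.pow 2).intervalIntegrable _ _)
          ((hHi _ _).sub hHs) fun t _ => by
            rw [← hdiff]; exact sq_intervalIntegral_unit_le hh t
    _ = (∫ t in (-1:ℝ)..0, H t) - ∫ t in (-(T + 1))..(-T), H t := by
        rw [intervalIntegral.integral_sub (hHi _ _) hHs,
          intervalIntegral.integral_comp_sub_right H,
          ← intervalIntegral.integral_add_adjacent_intervals (hHi (-T) (-1)) (hHi (-1) 0),
          show -T - 1 = -(T + 1) by ring, zero_sub,
          ← intervalIntegral.integral_add_adjacent_intervals (hHi (-(T + 1)) (-T)) (hHi (-T) (-1))]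
        ring
    _ ≤ 0 - H (-(T + 1)) := by
        have h1 : ∫ t in (-1:ℝ)..0, H t ≤ ∫ t in (-1:ℝ)..0, (0:ℝ) :=
          intervalIntegral.integral_mono_on (by norm_num) (hHi _ _) (by simp) fun t ht => by
            rw [← hH0]; exact hmono _ _ ht.2
        have h2 : ∫ t in (-(T + 1))..(-T), H (-(T + 1)) ≤ ∫ t in (-(T + 1))..(-T), H t :=
          intervalIntegral.integral_mono_on (by linarith) (by simp) (hHi _ _)
            fun t ht => hmono _ _ ht.1
        rw [intervalIntegral.integral_const, smul_eq_mul] at h1 h2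
        ring_nf at h1 h2 ⊢
        linarith
    _ = ∫ s in (-(T + 1))..0, h s ^ 2 := by rw [hdiff, hH0]

theorem intervalIntegral_unit_of_periodic_nonpos {f : ℝ → ℝ} (hf : ContinuousOn f (Iic 0))
    (hper : ∀ t ≤ 0, f (t - 1) = f t) {t : ℝ} (ht : t ≤ 0) :
    ∫ s in (t - 1)..t, f s = ∫ s in (-1:ℝ)..0, f s := by
  have hi : ∀ a b : ℝ, a ≤ 0 → b ≤ 0 → IntervalIntegrable f volume a b := fun a b ha hb =>
    (hf.mono fun s hs => (mem_uIcc.1 hs).elim (fun h => h.2.trans hb)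
      fun h => h.2.trans ha).intervalIntegrable
  have h1 : ∫ s in (t - 1)..(-1), f s = ∫ s in t..0, f s := by
    have h := intervalIntegral.integral_comp_sub_right (a := t) (b := 0) f 1
    rw [zero_sub] at h
    rw [← h]
    refine intervalIntegral.integral_congr fun s hs => hper s ?_
    rw [uIcc_of_le ht] at hs
    exact hs.2
  have h2 := intervalIntegral.integral_add_adjacent_intervals (hi (t - 1) t (by linarith) ht)
    (hi t 0 ht le_rfl)
  have h3 := intervalIntegral.integral_add_adjacent_intervals
    (hi (t - 1) (-1) (by linarith) (by norm_num)) (hi (-1) 0 (by norm_num) le_rfl)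
  linarith

end Averages

section Rigidity

variable {n : ℕ} {u g : En n → ℝ → ℝ} {G : En n → ℝ → En n}
  {D : En n → ℝ → Matrix (Fin n) (Fin n) ℝ} {f₁ : En n → ℝ} {f₂ : ℝ → ℝ} {m₁ m₂ τ : ℝ}
  {A : Matrix (Fin n) (Fin n) ℝ}

theorem ParabolicSolution.intervalIntegral_speed_sub
    (hS : ParabolicSolution u g G D f₁ f₂ m₁ m₂) (hf₂ : ContinuousOn f₂ (Iic 0))
    (hper₂ : ∀ t ≤ 0, f₂ (t - 1) = f₂ t) (havg₂ : ∫ t in Icc (-1:ℝ) 0, f₂ t = 1) (x : En n) {t : ℝ}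
    (ht : t ≤ 0) : ∫ s in (t - 1)..t, (g x s - τ * f₂ s) = u x (t - 1) - u x t - τ := by
  have hle : ∀ s ∈ uIcc (t - 1) t, s ≤ 0 := fun s hs => by
    rw [uIcc_of_le (by linarith)] at hs; exact hs.2.trans ht
  have hg : IntervalIntegrable (g x) volume (t - 1) t :=
    (hS.continuousOn_speed.comp (f := fun s => (x, s)) (by fun_prop)
      fun s hs => ⟨mem_univ _, hle s hs⟩).intervalIntegrable
  have hf : IntervalIntegrable f₂ volume (t - 1) t :=
    (hf₂.mono fun s hs => hle s hs).intervalIntegrable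
  have h := intervalIntegral.integral_eq_sub_of_hasDerivAt
    (fun s hs => hS.hasDerivAt x s (hle s hs)) hg.neg
  rw [intervalIntegral.integral_neg] at h
  rw [intervalIntegral.integral_sub hg (hf.const_mul τ), intervalIntegral.integral_const_mul,
    intervalIntegral_unit_of_periodic_nonpos hf₂ hper₂ ht,
    intervalIntegral.integral_of_le (by norm_num : (-1:ℝ) ≤ 0), ← integral_Icc_eq_integral_Ioc,
    havg₂]
  linarith

theorem ParabolicSolution.abs_increment_le
    (hS : ParabolicSolution u g G D f₁ f₂ m₁ m₂) (hf₂ : ContinuousOn f₂ (Iic 0))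
    (hper₂ : ∀ t ≤ 0, f₂ (t - 1) = f₂ t) (havg₂ : ∫ t in Icc (-1:ℝ) 0, f₂ t = 1) (x : En n) {t : ℝ}
    (ht : t ≤ 0) : |u x (t - 1) - u x t| ≤ m₂ := by
  have h := intervalIntegral.norm_integral_le_of_norm_le_const (a := t - 1) (b := t) (C := m₂)
    (f := fun s => g x s - 0 * f₂ s) fun s hs => by
      rw [uIoc_of_le (by linarith)] at hs
      have hs0 := hs.2.trans ht
      rw [zero_mul, sub_zero, Real.norm_of_nonneg (hS.speed_pos.le.trans (hS.le_speed x s hs0))]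
      exact hS.speed_le x s hs0
  rw [hS.intervalIntegral_speed_sub hf₂ hper₂ havg₂ x ht] at h
  simpa using h

theorem ParabolicSolution.setIntegral_sq_increment_sub_le
    (hS : ParabolicSolution u g G D f₁ f₂ m₁ m₂) (hf₂ : ContinuousOn f₂ (Iic 0))
    (hper₂ : ∀ t ≤ 0, f₂ (t - 1) = f₂ t) (havg₂ : ∫ t in Icc (-1:ℝ) 0, f₂ t = 1) (R : ℝ) {T : ℝ}
    (hT : 0 ≤ T) :
    ∫ q in centeredBox n R ×ˢ Icc (-T) 0, (u q.1 (q.2 - 1) - u q.1 q.2 - τ) ^ 2 ≤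
      ∫ q in centeredBox n R ×ˢ Icc (-(T + 1)) 0, (g q.1 q.2 - τ * f₂ q.2) ^ 2 := by
  have hcW : ContinuousOn (fun q : En n × ℝ => (u q.1 (q.2 - 1) - u q.1 q.2 - τ) ^ 2)
      (univ ×ˢ Iic 0) :=
    ((hS.continuousOn_shift.sub hS.continuousOn).sub continuousOn_const).pow 2
  have hch : ContinuousOn (fun q : En n × ℝ => (g q.1 q.2 - τ * f₂ q.2) ^ 2) (univ ×ˢ Iic 0) :=
    (hS.continuousOn_speed.sub ((hf₂.comp continuous_snd.continuousOn
      fun q hq => hq.2).const_mul τ)).pow 2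
  have iW := integrableOn_centeredBox_prod hcW R T
  have ih := integrableOn_centeredBox_prod hch R (T + 1)
  rw [Measure.volume_eq_prod] at iW ih ⊢
  rw [setIntegral_prod _ iW, setIntegral_prod _ ih]
  rw [IntegrableOn, ← Measure.prod_restrict] at iW ih
  refine setIntegral_mono_on iW.integral_prod_left ih.integral_prod_left
    (measurableSet_centeredBox n R) fun x _ => ?_
  have hcx : Continuous fun s => g x (min s 0) - τ * f₂ (min s 0) := by
    refine Continuous.sub ?_ (Continuous.const_mul ?_ τ)
    · exact hS.continuousOn_speed.comp_continuous (f := fun s => (x, min s 0)) (by fun_prop)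
        fun s => ⟨mem_univ _, mem_Iic.2 (min_le_right _ _)⟩
    · exact hf₂.comp_continuous (by fun_prop) fun s => mem_Iic.2 (min_le_right _ _)
  have hmain := intervalIntegral_sq_average_le hcx hT
  rw [intervalIntegral.integral_of_le (by linarith), ← integral_Icc_eq_integral_Ioc,
    intervalIntegral.integral_of_le (by linarith), ← integral_Icc_eq_integral_Ioc] at hmain
  have eL : ∫ t in Icc (-T) 0, (u x (t - 1) - u x t - τ) ^ 2 =
      ∫ t in Icc (-T) 0, (∫ s in (t - 1)..t, (g x (min s 0) - τ * f₂ (min s 0))) ^ 2 := by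
    refine setIntegral_congr_fun measurableSet_Icc fun t ht => ?_
    rw [← hS.intervalIntegral_speed_sub hf₂ hper₂ havg₂ x ht.2]
    congr 1
    refine intervalIntegral.integral_congr fun s hs => ?_
    rw [uIcc_of_le (by linarith)] at hs
    simp only [min_eq_left (hs.2.trans ht.2)]
  have eR : ∫ s in Icc (-(T + 1)) 0, (g x s - τ * f₂ s) ^ 2 =
      ∫ s in Icc (-(T + 1)) 0, (g x (min s 0) - τ * f₂ (min s 0)) ^ 2 :=
    setIntegral_congr_fun measurableSet_Icc fun s hs => by simp only [min_eq_left hs.2]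
  simp only
  rw [eL, eR]
  exact hmain

theorem mem_centeredBox_of_norm_lt {R : ℝ} {x : En n} (hx : ‖x‖ < R) : x ∈ centeredBox n R :=
  fun i => by
    have h := abs_lt.1 ((PiLp.norm_apply_le x i).trans_lt hx)
    exact ⟨h.1.le, h.2⟩

/-- The unit-time increment of `u` is constant. -/
theorem ParabolicSolution.increment_eq
    (hS : ParabolicSolution u g G D f₁ f₂ m₁ m₂) (hu : AsymptoticallyQuadratic u A τ)
    (hA : A.IsSymm) (hApos : A.PosDef) (hdetA : τ * A.det = 1)
    (hτ : 0 < τ) (hf₁ : Continuous f₁) (hf₂ : ContinuousOn f₂ (Iic 0)) {ℓ Λ : ℝ} (hℓ : 0 < ℓ)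
    (hf₁ℓ : ∀ x, ℓ ≤ f₁ x) (hf₂pos : ∀ t ≤ 0, 0 < f₂ t)
    (hf : ∀ x, ∀ t ≤ 0, 0 < f₁ x * f₂ t ∧ f₁ x * f₂ t ≤ Λ)
    (hper₁ : ∀ (x : En n) (i : Fin n), f₁ (x + EuclideanSpace.single i 1) = f₁ x)
    (hper₂ : ∀ t ≤ 0, f₂ (t - 1) = f₂ t)
    (havg₁ : ∫ x in {x : En n | ∀ i, x i ∈ Icc (0:ℝ) 1}, f₁ x = 1)
    (havg₂ : ∫ t in Icc (-1:ℝ) 0, f₂ t = 1) (x : En n) {t : ℝ} (ht : t ≤ 0) :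
    u x (t - 1) - u x t = τ := by
  have hΛ : 0 < Λ := (hf 0 0 le_rfl).1.trans_le (hf 0 0 le_rfl).2
  obtain ⟨a₀, ha₀, hquad⟩ := exists_pos_mul_sq_norm_le_quadForm hApos
  obtain ⟨C₁, hlow⟩ : ∃ C₁, ∀ x, ∀ t ≤ 0, a₀ / 4 * ‖x‖ ^ 2 + 15 / 16 * τ * -t - C₁ ≤ u x t := by
    obtain ⟨C, -, hC⟩ := hu (min (a₀ / 4) (τ / 16)) (by positivity)
    refine ⟨C, fun x t ht => ?_⟩
    have h1 := (abs_le.1 (hC x t ht)).1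
    have h2 := hquad x
    have h3 : min (a₀ / 4) (τ / 16) * ‖x‖ ^ 2 ≤ a₀ / 4 * ‖x‖ ^ 2 := by
      gcongr; exact min_le_left _ _
    have h4 : min (a₀ / 4) (τ / 16) * -t ≤ τ / 16 * -t :=
      mul_le_mul_of_nonneg_right (min_le_right _ _) (by linarith)
    linarith
  set κ := √(a₀ * τ / 32) with hκdef
  have hκ : 0 < κ := by positivity
  have hκ2 : 32 * κ ^ 2 = a₀ * τ := by
    rw [hκdef, Real.sq_sqrt (by positivity)]; ring
  obtain ⟨K, hK, hK2⟩ : ∃ K : ℕ, (0:ℝ) < K ∧ 8 * τ ≤ a₀ * (K:ℝ) ^ 2 := by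
    obtain ⟨K, hK⟩ := exists_nat_ge (8 * τ / a₀ + 1)
    have h0 : 0 < 8 * τ / a₀ := by positivity
    refine ⟨K, by linarith, ?_⟩
    have h1 : 8 * τ / a₀ ≤ (K:ℝ) ^ 2 := by nlinarith
    rw [div_le_iff₀ ha₀] at h1
    linarith
  have hμ := densityConst_pos (n := n) hτ hΛ hκ
  set μ := densityConst n τ Λ κ
  -- The increment cannot stay a fixed distance from `τ` on a set of positive density.
  have hsparse : ∀ β > 0, ¬ ∀ᶠ N : ℕ in Filter.atTop, ENNReal.ofReal (μ * (N:ℝ) ^ (n + 2)) ≤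
      volume {q : En n × ℝ | ‖q.1‖ < K * N ∧ q.2 ∈ Ioc (-(N:ℝ) ^ 2) 0 ∧
        β ≤ |u q.1 (q.2 - 1) - u q.1 q.2 - τ|} := by
    intro β hβ hev
    obtain ⟨N, hN, hE, hN1⟩ := (hev.and ((hS.eventually_setIntegral_sq_speed_sub_le hu hA hApos
      hdetA hτ hf₁ hf₂ hℓ hf₁ℓ hf₂pos hper₁ hper₂ havg₁ havg₂ K
      (show 0 < β ^ 2 * μ / 2 by positivity)).and
      (tendsto_natCast_atTop_atTop.eventually_ge_atTop (1:ℝ)))).exists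
    have hW := (hS.setIntegral_sq_increment_sub_le (τ := τ) hf₂ hper₂ havg₂ (K * N)
      (sq_nonneg (N:ℝ))).trans hE
    set S := centeredBox n (K * N : ℝ) ×ˢ Icc (-(N:ℝ) ^ 2) 0 with hSdef
    have hSm : MeasurableSet S := (measurableSet_centeredBox n _).prod measurableSet_Icc
    have hcW : ContinuousOn (fun q : En n × ℝ => (u q.1 (q.2 - 1) - u q.1 q.2 - τ) ^ 2)
        (univ ×ˢ Iic 0) :=
      ((hS.continuousOn_shift.sub hS.continuousOn).sub continuousOn_const).pow 2
    have hInt := integrableOn_centeredBox_prod hcW (K * N) ((N:ℝ) ^ 2)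
    have hcheb := mul_meas_ge_le_integral_of_nonneg (μ := volume.restrict S)
      (Filter.Eventually.of_forall fun q => sq_nonneg _) hInt (β ^ 2)
    have hsub : volume {q : En n × ℝ | ‖q.1‖ < K * N ∧ q.2 ∈ Ioc (-(N:ℝ) ^ 2) 0 ∧
        β ≤ |u q.1 (q.2 - 1) - u q.1 q.2 - τ|} ≤ (volume.restrict S)
          {q | β ^ 2 ≤ (u q.1 (q.2 - 1) - u q.1 q.2 - τ) ^ 2} := by
      rw [Measure.restrict_apply' hSm]
      refine measure_mono fun q hq => ⟨?_, mem_centeredBox_of_norm_lt hq.1,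
        Ioc_subset_Icc_self hq.2.1⟩
      rw [mem_ofPred_eq, ← sq_abs (u q.1 (q.2 - 1) - u q.1 q.2 - τ)]
      gcongr
      exact hq.2.2
    have hfin : (volume.restrict S) {q | β ^ 2 ≤ (u q.1 (q.2 - 1) - u q.1 q.2 - τ) ^ 2} ≠ ⊤ := by
      refine ((measure_mono (subset_univ _)).trans_lt ?_).ne
      have h1 := integrableOn_centeredBox_prod (n := n) (F := fun _ => (1:ℝ))
        continuousOn_const (K * N) ((N:ℝ) ^ 2)
      simpa [integrableOn_const_iff] using h1
    have hμN : μ * (N:ℝ) ^ (n + 2) ≤ (volume.restrict S).real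
        {q | β ^ 2 ≤ (u q.1 (q.2 - 1) - u q.1 q.2 - τ) ^ 2} :=
      (ENNReal.ofReal_le_iff_le_toReal hfin).1 (hN.trans hsub)
    have hNpos : 0 < (N:ℝ) ^ (n + 2) := by positivity
    have h1 : β ^ 2 * (μ * (N:ℝ) ^ (n + 2)) ≤ β ^ 2 * μ / 2 * (N:ℝ) ^ (n + 2) :=
      (mul_le_mul_of_nonneg_left hμN (sq_nonneg β)).trans (hcheb.trans hW)
    have h2 : 0 < β ^ 2 * μ * (N:ℝ) ^ (n + 2) := by positivity
    linarith
  set P : Set (En n × ℝ) := univ ×ˢ Iic 0 with hP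
  set W : En n × ℝ → ℝ := fun q => u q.1 (q.2 - 1) - u q.1 q.2 with hWdef
  have hne : (W '' P).Nonempty := ⟨_, mem_image_of_mem W (show (0, 0) ∈ P by simp [hP])⟩
  have hbd : ∀ q ∈ P, |W q| ≤ m₂ := fun q hq =>
    hS.abs_increment_le hf₂ hper₂ havg₂ q.1 hq.2
  have habove : BddAbove (W '' P) :=
    ⟨m₂, forall_mem_image.2 fun q hq => (abs_le.1 (hbd q hq)).2⟩
  have hbelow : BddBelow (W '' P) :=
    ⟨-m₂, forall_mem_image.2 fun q hq => (abs_le.1 (hbd q hq)).1⟩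
  have hsup : sSup (W '' P) ≤ τ := by
    by_contra! hlt
    set M := sSup (W '' P)
    obtain ⟨_, ⟨⟨x₀, t₀⟩, hq₀, rfl⟩, h₀⟩ :=
      exists_lt_of_lt_csSup hne (show M - (M - τ) / 8 < M by linarith)
    refine hsparse ((M - τ) / 2) (by linarith) ((hS.le_volume_near_sup ha₀ hτ hκ hκ2 hK hK2 hΛ
      (show 0 < (M - τ) / 8 by linarith) hlow hper₂ hf
      (fun x t ht => le_csSup habove (mem_image_of_mem W (show (x, t) ∈ P from ⟨mem_univ _, ht⟩)))
      hq₀.2 h₀.le).mono fun N hN => hN.trans (measure_mono ?_))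
    rintro q ⟨h1, h2, h3⟩
    exact ⟨h1, h2, le_abs.2 (Or.inl (by linarith))⟩
  have hinf : τ ≤ sInf (W '' P) := by
    by_contra! hlt
    set m := sInf (W '' P)
    obtain ⟨_, ⟨⟨x₀, t₀⟩, hq₀, rfl⟩, h₀⟩ :=
      exists_lt_of_csInf_lt hne (show m < m + (τ - m) / 8 by linarith)
    refine hsparse ((τ - m) / 2) (by linarith) ((hS.le_volume_near_inf ha₀ hτ hκ hκ2 hK hK2 hΛ
      (show 0 < (τ - m) / 8 by linarith) hlow hper₂ hf
      (fun x t ht => csInf_le hbelow (mem_image_of_mem W (show (x, t) ∈ P from ⟨mem_univ _, ht⟩)))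
      hq₀.2 h₀.le).mono fun N hN => hN.trans (measure_mono ?_))
    rintro q ⟨h1, h2, h3⟩
    exact ⟨h1, h2, le_abs.2 (Or.inr (by linarith))⟩
  have hmem : W (x, t) ∈ W '' P := mem_image_of_mem W ⟨mem_univ _, ht⟩
  exact le_antisymm ((le_csSup habove hmem).trans hsup) (hinf.trans (csInf_le hbelow hmem))

end Rigidity
/-- the time difference quotients are exactly `-τ`. -/
theorem stmt18
    (n : ℕ) (hn : 1 ≤ n) (α : ℝ) (hα : α ∈ Set.Ioo (0:ℝ) 1)
    (f₁ : En n → ℝ) (f₂ : ℝ → ℝ)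
    (hf₁pos : ∀ x, 0 < f₁ x) (hf₂pos : ∀ t : ℝ, t ≤ 0 → 0 < f₂ t)
    (hf₁hold : ∃ K : NNReal, HolderWith K α.toNNReal f₁)
    (hf₂hold : ∃ K : NNReal, HolderOnWith K (α/2).toNNReal f₂ (Set.Iic 0))
    (hf₁per : ∀ (x : En n) (i : Fin n), f₁ (x + EuclideanSpace.single i 1) = f₁ x)
    (hf₂per : ∀ t : ℝ, t ≤ 0 → f₂ (t - 1) = f₂ t)
    (hf₁avg : ∫ x in {x : En n | ∀ i, x i ∈ Set.Icc (0:ℝ) 1}, f₁ x = 1)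
    (hf₂avg : ∫ t in Set.Icc (-1:ℝ) 0, f₂ t = 1)
    (lam Λ : ℝ) (hlam : 0 < lam)
    (hfbdd : ∀ (x : En n) (t : ℝ), t ≤ 0 → lam ≤ f₁ x * f₂ t ∧ f₁ x * f₂ t ≤ Λ)
    (u : En n → ℝ → ℝ)
    (hureg : PMA.IsC2kOn 1 u (PMA.halfSpace n))
    (huconv : PMA.ParabolicallyConvexOn (PMA.halfSpace n) u)
    (m₁ m₂ : ℝ) (hm₁ : 0 < m₁) (hm₂ : 0 < m₂)
    (hut : ∀ (x : En n) (t : ℝ), t ≤ 0 →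
      m₁ ≤ -PMA.timeDeriv u x t ∧ -PMA.timeDeriv u x t ≤ m₂)
    (heq : ∀ (x : En n) (t : ℝ), t ≤ 0 →
      -PMA.timeDeriv u x t * (PMA.spaceHess u x t).det = f₁ x * f₂ t)
    (hu0 : u 0 0 = 0) (hDu0 : PMA.spaceGrad u 0 0 = 0)
    (τ : ℝ) (hτ : τ ∈ Set.Icc m₁ m₂)
    (A : Matrix (Fin n) (Fin n) ℝ) (hAsymm : A.IsSymm) (hApos : A.PosDef)
    (hdetA : τ * A.det = 1)
    (ε C₀ : ℝ) (hε : ε ∈ Set.Ioo (0:ℝ) 1) (hC₀ : 0 < C₀)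
    (hasym : ∀ (x : En n) (t : ℝ), t ≤ 0 → C₀ ≤ ‖x‖^2 - t →
      |u x t - ((1/2) * PMA.quadForm A x - τ * t)| ≤ C₀ * (‖x‖^2 - t) ^ ((4-ε)/4))
    :
    ∀ (x : En n) (t : ℝ), t ≤ 0 → ∀ k : ℕ, 0 < k →
      (u x t - u x (t - k)) / k = -τ := by
  have hτ0 : 0 < τ := hm₁.trans_le hτ.1
  have hf0 : ∀ x t, t ≤ 0 → 0 < f₁ x * f₂ t := fun x t ht => mul_pos (hf₁pos x) (hf₂pos t ht)
  have hS := parabolicSolution_of_isC2kOn hureg huconv hm₁ hut heq hf0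
  have hu : AsymptoticallyQuadratic u A τ := fun σ hσ =>
    exists_abs_sub_quadratic_le (by linarith [hε.1] : (4 - ε) / 4 < 1) hS.continuousOn hasym hσ
  obtain ⟨K₁, hK₁⟩ := hf₁hold
  obtain ⟨K₂, hK₂⟩ := hf₂hold
  have hstep : ∀ x, ∀ t ≤ 0, u x (t - 1) - u x t = τ := fun x t ht =>
    hS.increment_eq hu hAsymm hApos hdetA hτ0 (hK₁.continuous (by simpa using hα.1))
      (hK₂.continuousOn (by simpa using hα.1)) (div_pos hlam (hf₂pos 0 le_rfl))
      (fun y => (div_le_iff₀ (hf₂pos 0 le_rfl)).2 (hfbdd y 0 le_rfl).1) hf₂pos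
      (fun y s hs => ⟨hf0 y s hs, (hfbdd y s hs).2⟩) hf₁per hf₂per hf₁avg hf₂avg x ht
  intro x t ht k hk
  have hsum : ∀ j : ℕ, u x (t - j) - u x t = j * τ := by
    intro j
    induction j with
    | zero => simp
    | succ j ih =>
      have h := hstep x (t - j) (by linarith [(Nat.cast_nonneg j : (0:ℝ) ≤ j)])
      rw [sub_sub] at h
      push_cast
      linarith
  have hk0 : (0:ℝ) < k := Nat.cast_pos.2 hk
  rw [div_eq_iff hk0.ne']
  linarith [hsum k]
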